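/- arXiv:1212.4712 — 4 statements merged into one kernel-verified Lean document; each statement's English description precedes it below -/
import Mathlib

section
/- For every integer n ≥ 0, define F_n : ℝ³ → ℝ by F_n(v) = 2^{−5/4}·(2π)^{−3/4}·√(n!/(π·Γ(n+3/2)))·L_n^{(1/2)}(|v|²/2)·e^{−|v|²/2}, where L_n^{(1/2)}(x) = Σ_{k=0}^{n} ((−1)^k/k!)·(Γ(n+3/2)/(Γ(k+3/2)·(n−k)!))·x^k is the generalized Laguerre polynomial of order 1/2 and Γ denotes the real Gamma function. Then the Fourier transform of F_n satisfies ∫_{ℝ³} F_n(v)·e^{−i v·ξ} dv = (1/√((2n+1)!))·|ξ|^{2n}·e^{−|ξ|²/2} for every ξ ∈ ℝ³. -/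
open Real MeasureTheory RealInnerProductSpace

/-- The generalized Laguerre polynomial of order `1/2`. -/
noncomputable def laguerreHalf (n : ℕ) (x : ℝ) : ℝ :=
  ∑ k ∈ Finset.range (n+1),
    ((-1:ℝ)^k / (Nat.factorial k)) *
      (Real.Gamma ((n:ℝ) + 3/2) / (Real.Gamma ((k:ℝ) + 3/2) * (Nat.factorial (n - k)))) * x^k

/-- `F_n = μ₃^{1/2} · φ_{n,0,0}` where `φ_{n,0,0}` is the radial Hermite eigenfunction. -/
noncomputable def Fn (n : ℕ) (v : EuclideanSpace ℝ (Fin 3)) : ℝ :=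
  (2:ℝ) ^ (-(5:ℝ)/4) * (2*Real.pi) ^ (-(3:ℝ)/4) *
    Real.sqrt ((Nat.factorial n : ℝ) / (Real.pi * Real.Gamma ((n:ℝ) + 3/2))) *
    laguerreHalf n (‖v‖^2/2) * Real.exp (-‖v‖^2/2)

noncomputable def hK (ξ : EuclideanSpace ℝ (Fin 3)) (k : ℕ) (b : ℝ)
    (v : EuclideanSpace ℝ (Fin 3)) : ℂ :=
  (((‖v‖^2)^k * Real.exp (-b * ‖v‖^2) : ℝ) : ℂ) *
    Complex.exp (-Complex.I * ((⟪v, ξ⟫ : ℝ) : ℂ))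

noncomputable def hR (r : ℝ) (n : ℕ) (b : ℝ) : ℝ :=
  π ^ ((3:ℝ)/2) * r^n / (Nat.factorial n) * b ^ (-((n:ℝ) + 3/2)) * Real.exp (-r/b)

noncomputable def hc (n k : ℕ) : ℝ :=
  (-1:ℝ)^k * (Real.Gamma ((n:ℝ) + 3/2) / Real.Gamma ((k:ℝ) + 3/2)) * (n.choose k)
    / (Nat.factorial n)

lemma hK_norm (ξ : EuclideanSpace ℝ (Fin 3)) (k : ℕ) (b : ℝ) (v : EuclideanSpace ℝ (Fin 3)) :
    ‖hK ξ k b v‖ = (‖v‖^2)^k * Real.exp (-b * ‖v‖^2) := by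
  have h : ‖Complex.exp (-Complex.I * ((⟪v, ξ⟫ : ℝ) : ℂ))‖ = 1 := by
    rw [Complex.norm_exp]; simp
  rw [hK, norm_mul, h, mul_one, Complex.norm_real, Real.norm_of_nonneg (by positivity)]

lemma hK_cont (ξ : EuclideanSpace ℝ (Fin 3)) (k : ℕ) (b : ℝ) : Continuous (hK ξ k b) := by
  unfold hK
  fun_prop

lemma gauss_int {b : ℝ} (hb : 0 < b) :
    Integrable (fun v : EuclideanSpace ℝ (Fin 3) => Real.exp (-b * ‖v‖^2)) := by
  have := (GaussianFourier.integrable_cexp_neg_mul_sq_norm_add (V := EuclideanSpace ℝ (Fin 3))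
    (b := (b:ℂ)) (by simpa using hb) 0 0).norm
  refine this.congr (Filter.Eventually.of_forall fun v => ?_)
  simp only [Complex.norm_exp]
  congr 1
  simp [← Complex.ofReal_pow]

lemma poly_gauss_int {b : ℝ} (hb : 0 < b) (k : ℕ) :
    Integrable (fun v : EuclideanSpace ℝ (Fin 3) => (‖v‖^2)^k * Real.exp (-b * ‖v‖^2)) := by
  refine ((gauss_int (half_pos hb)).const_mul (k.factorial / (b/2)^k)).mono'
    (by fun_prop) (Filter.Eventually.of_forall fun v => ?_)
  rw [Real.norm_of_nonneg (by positivity)]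
  have h := Real.pow_div_factorial_le_exp (b/2*‖v‖^2) (by positivity) k
  have e : Real.exp (-(b/2) * ‖v‖^2) = Real.exp (b/2*‖v‖^2) * Real.exp (-b * ‖v‖^2) := by
    rw [← Real.exp_add]; congr 1; ring
  rw [e, ← mul_assoc]
  gcongr
  rw [mul_pow, div_le_iff₀ (by positivity)] at h
  rw [div_mul_eq_mul_div, le_div_iff₀ (by positivity)]
  linarith

lemma hK_int (ξ : EuclideanSpace ℝ (Fin 3)) (k : ℕ) {b : ℝ} (hb : 0 < b) :
    Integrable (hK ξ k b) :=
  (poly_gauss_int hb k).mono' (hK_cont ξ k b).aestronglyMeasurable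
    (Filter.Eventually.of_forall fun v => (hK_norm ξ k b v).le)

lemma hI_deriv (ξ : EuclideanSpace ℝ (Fin 3)) (k : ℕ) {b : ℝ} (hb : 0 < b) :
    HasDerivAt (fun b => ∫ v, hK ξ k b v) (-∫ v, hK ξ (k+1) b v) b := by
  rw [← integral_neg]
  refine (hasDerivAt_integral_of_dominated_loc_of_deriv_le (F := fun b v => hK ξ k b v)
    (F' := fun b v => - hK ξ (k+1) b v) (s := Set.Ioi (b/2))
    (bound := fun v => (‖v‖^2)^(k+1) * Real.exp (-(b/2) * ‖v‖^2))
    (Ioi_mem_nhds (by linarith))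
    (Filter.Eventually.of_forall fun x => (hK_cont ξ k x).aestronglyMeasurable)
    (hK_int ξ k hb) (hK_cont ξ (k+1) b).neg.aestronglyMeasurable
    (Filter.Eventually.of_forall fun v x hx => ?_)
    (poly_gauss_int (half_pos hb) (k+1))
    (Filter.Eventually.of_forall fun v x hx => ?_)).2
  · rw [norm_neg, hK_norm]
    have : b/2 < x := hx
    gcongr
  · unfold hK
    have h1 : HasDerivAt (fun x : ℝ => (‖v‖^2)^k * Real.exp (-x * ‖v‖^2))
        ((‖v‖^2)^k * (Real.exp (-x * ‖v‖^2) * (-1 * ‖v‖^2))) x :=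
      (((hasDerivAt_id x).neg.mul_const (‖v‖^2)).exp).const_mul _
    refine (h1.ofReal_comp.mul_const (Complex.exp (-Complex.I * ((⟪v, ξ⟫ : ℝ) : ℂ)))).congr_deriv ?_
    push_cast
    ring

lemma hR_deriv (r : ℝ) (n : ℕ) {b : ℝ} (hb : 0 < b) :
    HasDerivAt (hR r n) ((((n:ℝ)+1) * hR r (n+1) b - ((n:ℝ)+3/2) * hR r n b) / b) b := by
  have h1 := Real.hasDerivAt_rpow_const (x := b) (p := -((n:ℝ) + 3/2)) (Or.inl hb.ne')
  have h2 : HasDerivAt (fun b : ℝ => Real.exp (-r/b)) (Real.exp (-r/b) * (-r * (-(b^2)⁻¹))) b := by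
    simpa [div_eq_mul_inv] using ((hasDerivAt_inv hb.ne').const_mul (-r)).exp
  have h3 := (h1.const_mul (π ^ ((3:ℝ)/2) * r^n / (Nat.factorial n))).mul h2
  have e1 : b ^ (-((n:ℝ) + 3/2) - 1) = b ^ (-((n:ℝ) + 3/2)) / b := by
    rw [Real.rpow_sub hb, Real.rpow_one]
  have e2 : b ^ (-(((n+1:ℕ):ℝ) + 3/2)) = b ^ (-((n:ℝ) + 3/2)) / b := by
    rw [← e1]; congr 1; push_cast; ring
  refine h3.congr_deriv ?_
  unfold hR
  rw [e2, e1, Nat.factorial_succ]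
  push_cast
  have : ((n:ℝ)+1) ≠ 0 := by positivity
  field_simp
  ring

lemma hc_rec (n k : ℕ) : ((n:ℝ)+1) * hc (n+1) (k+1) =
    ((k:ℝ)+1 + n + 3/2) * hc n (k+1) - hc n k := by
  have gn : Real.Gamma (((n+1:ℕ):ℝ) + 3/2) = (n+3/2) * Real.Gamma ((n:ℝ) + 3/2) := by
    rw [← Real.Gamma_add_one (by positivity)]; congr 1; push_cast; ring
  have gk : Real.Gamma (((k+1:ℕ):ℝ) + 3/2) = (k+3/2) * Real.Gamma ((k:ℝ) + 3/2) := by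
    rw [← Real.Gamma_add_one (by positivity)]; congr 1; push_cast; ring
  have hk : Real.Gamma ((k:ℝ) + 3/2) ≠ 0 := (Real.Gamma_pos_of_pos (by positivity)).ne'
  have hch : ((k:ℝ)+1) * (n.choose (k+1)) = (n - k) * n.choose k := by
    rcases le_or_gt k n with h | h
    · have := Nat.choose_succ_right_eq n k
      have h2 : ((n.choose (k+1) * (k+1) : ℕ) : ℝ) = ((n.choose k * (n-k) : ℕ) : ℝ) := by rw [this]
      push_cast [Nat.cast_sub h] at h2
      linarith
    · simp [Nat.choose_eq_zero_of_lt h, Nat.choose_eq_zero_of_lt (Nat.lt_succ_of_lt h)]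
  unfold hc
  rw [gn, gk, Nat.choose_succ_succ, Nat.factorial_succ]
  push_cast
  have h1 : ((n:ℝ)+1) ≠ 0 := by positivity
  have h2 : ((k:ℝ)+3/2) ≠ 0 := by positivity
  have h3 : (n.factorial:ℝ) ≠ 0 := by positivity
  generalize Real.Gamma ((k:ℝ) + 3/2) = G at *
  generalize Real.Gamma ((n:ℝ) + 3/2) = H at *
  rw [← sub_eq_zero]
  have key : ((k:ℝ)+1) * (n.choose (k+1)) - (n - k) * n.choose k = 0 := by linarith
  trans (((-1)^k * H / G / n.factorial / (k+3/2)) *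
    (((k:ℝ)+1) * (n.choose (k+1)) - (n - k) * n.choose k))
  · field_simp
    ring
  · rw [key, mul_zero]

lemma hc_rec0 (n : ℕ) : ((n:ℝ)+1) * hc (n+1) 0 = ((n:ℝ) + 3/2) * hc n 0 := by
  have gn : Real.Gamma (((n+1:ℕ):ℝ) + 3/2) = (n+3/2) * Real.Gamma ((n:ℝ) + 3/2) := by
    rw [← Real.Gamma_add_one (by positivity)]; congr 1; push_cast; ring
  unfold hc
  rw [gn, Nat.factorial_succ]
  push_cast
  have h1 : ((n:ℝ)+1) ≠ 0 := by positivity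
  simp only [Nat.choose_zero_right]
  field_simp

lemma hc_zero {n k : ℕ} (h : n < k) : hc n k = 0 := by
  simp [hc, Nat.choose_eq_zero_of_lt h]

lemma sum_rec (n : ℕ) (a : ℕ → ℂ) :
    ((n:ℂ)+1) * ∑ k ∈ Finset.range (n+2), (hc (n+1) k : ℂ) * a k =
      ∑ k ∈ Finset.range (n+1), (hc n k : ℂ) * (k * a k - a (k+1)) +
      ((n:ℂ)+3/2) * ∑ k ∈ Finset.range (n+1), (hc n k : ℂ) * a k := by
  have hx : ∀ f : ℕ → ℂ, ∑ k ∈ Finset.range (n+1), (hc n k : ℂ) * f k =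
      ∑ k ∈ Finset.range (n+2), (hc n k : ℂ) * f k := by
    intro f
    rw [Finset.sum_range_succ _ (n+1), hc_zero (Nat.lt_succ_self n)]; simp
  have e : ∑ k ∈ Finset.range (n+1), (hc n k : ℂ) * (k * a k - a (k+1)) =
      ∑ k ∈ Finset.range (n+2), (hc n k : ℂ) * (k * a k) -
      ∑ k ∈ Finset.range (n+1), (hc n k : ℂ) * a (k+1) := by
    rw [← hx, ← Finset.sum_sub_distrib]
    exact Finset.sum_congr rfl fun k _ => by ring
  rw [e, hx a, Finset.sum_range_succ' _ (n+1), Finset.sum_range_succ' _ (n+1),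
    Finset.sum_range_succ' _ (n+1)]
  have h0 : ((n:ℂ)+1) * (hc (n+1) 0 : ℂ) = ((n:ℂ) + 3/2) * hc n 0 := by
    have := congrArg (Complex.ofReal) (hc_rec0 n)
    push_cast at this
    exact this
  have h1 : ((n:ℂ)+1) * ∑ k ∈ Finset.range (n+1), (hc (n+1) (k+1) : ℂ) * a (k+1) =
      ∑ k ∈ Finset.range (n+1), (hc n (k+1) : ℂ) * ((k+1:ℕ) * a (k+1)) -
      ∑ k ∈ Finset.range (n+1), (hc n k : ℂ) * a (k+1) +
      ((n:ℂ)+3/2) * ∑ k ∈ Finset.range (n+1), (hc n (k+1) : ℂ) * a (k+1) := by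
    rw [Finset.mul_sum, Finset.mul_sum, ← Finset.sum_sub_distrib, ← Finset.sum_add_distrib]
    refine Finset.sum_congr rfl fun k _ => ?_
    have := congrArg (Complex.ofReal) (hc_rec n k)
    push_cast at this ⊢
    linear_combination a (k+1) * this
  rw [mul_add, h1]
  push_cast
  linear_combination a 0 * h0

lemma base_int (ξ : EuclideanSpace ℝ (Fin 3)) {b : ℝ} (hb : 0 < b) :
    ∫ v, hK ξ 0 b v = (hR (‖ξ‖^2/4) 0 b : ℂ) := by
  have h := GaussianFourier.integral_cexp_neg_mul_sq_norm_add (V := EuclideanSpace ℝ (Fin 3))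
    (b := (b:ℂ)) (by simpa using hb) (-Complex.I) ξ
  have e : ∀ v, hK ξ 0 b v =
      Complex.exp (-(b:ℂ) * (‖v‖:ℂ)^2 + -Complex.I * ((⟪ξ, v⟫ : ℝ) : ℂ)) := by
    intro v
    rw [hK, Complex.exp_add, real_inner_comm]
    push_cast
    simp
  simp_rw [e]
  rw [h]
  have e1 : -(‖ξ‖^2/4)/b = -‖ξ‖^2/(4*b) := by field_simp
  have e2 : π ^ ((3:ℝ)/2) * b ^ (-((0:ℝ) + 3/2)) = (π/b) ^ ((3:ℝ)/2) := by
    rw [Real.div_rpow pi_pos.le hb.le, zero_add, Real.rpow_neg hb.le]; rfl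
  have e3 : hR (‖ξ‖^2/4) 0 b = (π/b) ^ ((3:ℝ)/2) * Real.exp (-‖ξ‖^2/(4*b)) := by
    rw [hR, e1, ← e2]; simp
  rw [e3]
  push_cast
  rw [Complex.ofReal_cpow (by positivity)]
  simp

lemma main_int (ξ : EuclideanSpace ℝ (Fin 3)) (n : ℕ) : ∀ b : ℝ, 0 < b →
    ∑ k ∈ Finset.range (n+1), (hc n k : ℂ) * ((b:ℂ)^k * ∫ v, hK ξ k b v) =
      (hR (‖ξ‖^2/4) n b : ℂ) := by
  induction n with
  | zero =>
    intro b hb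
    have : Real.Gamma (3/2) ≠ 0 := (Real.Gamma_pos_of_pos (by norm_num)).ne'
    simp [base_int ξ hb, hc, this]
  | succ n ih =>
    intro b hb
    have hbC : (b:ℂ) ≠ 0 := by exact_mod_cast hb.ne'
    have d1 := (hR_deriv (‖ξ‖^2/4) n hb).ofReal_comp
    have d2 : HasDerivAt (fun b : ℝ => ∑ k ∈ Finset.range (n+1),
        (hc n k : ℂ) * ((b:ℂ)^k * ∫ v, hK ξ k b v))
        (∑ k ∈ Finset.range (n+1), (hc n k : ℂ) *
          (((k * b^(k-1) : ℝ) : ℂ) * (∫ v, hK ξ k b v) + (b:ℂ)^k * (-∫ v, hK ξ (k+1) b v))) b := by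
      refine HasDerivAt.fun_sum fun k _ => ?_
      refine HasDerivAt.const_mul _ ?_
      have := (hasDerivAt_pow k b).ofReal_comp
      simp only [Complex.ofReal_pow] at this
      exact this.mul (hI_deriv ξ k hb)
    have d3 := d2.congr_of_eventuallyEq (f₁ := fun y => (hR (‖ξ‖^2/4) n y : ℂ))
      (by filter_upwards [Ioi_mem_nhds hb] with y hy using (ih y hy).symm)
    have u := d1.unique d3
    have s := sum_rec n (fun k => (b:ℂ)^k * ∫ v, hK ξ k b v)
    rw [ih b hb] at s
    have t : ∑ k ∈ Finset.range (n+1), (hc n k : ℂ) * (k * ((b:ℂ)^k * ∫ v, hK ξ k b v) -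
        (b:ℂ)^(k+1) * ∫ v, hK ξ (k+1) b v) = b * ∑ k ∈ Finset.range (n+1), (hc n k : ℂ) *
          (((k * b^(k-1) : ℝ) : ℂ) * (∫ v, hK ξ k b v) + (b:ℂ)^k * (-∫ v, hK ξ (k+1) b v)) := by
      rw [Finset.mul_sum]
      refine Finset.sum_congr rfl fun k _ => ?_
      rcases k with _ | k
      · simp; ring
      · push_cast
        ring
    rw [t, ← u] at s
    push_cast at s
    rw [mul_div_cancel₀ _ hbC] at s
    have hn : ((n:ℂ)+1) ≠ 0 := by exact_mod_cast Nat.succ_ne_zero n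
    apply mul_left_cancel₀ hn
    rw [s]
    ring

lemma gamma_fact (n : ℕ) : Real.Gamma ((n:ℝ) + 3/2) =
    (Nat.factorial (2*n+1)) * √π / (2^(2*n+1) * Nat.factorial n) := by
  induction n with
  | zero =>
    have : (3/2:ℝ) = 1/2 + 1 := by norm_num
    simp only [Nat.cast_zero, zero_add]
    rw [this, Real.Gamma_add_one (by norm_num), Real.Gamma_one_half_eq]
    simp; ring
  | succ n ih =>
    have gn : Real.Gamma (((n+1:ℕ):ℝ) + 3/2) = (n+3/2) * Real.Gamma ((n:ℝ) + 3/2) := by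
      rw [← Real.Gamma_add_one (by positivity)]; congr 1; push_cast; ring
    rw [gn, ih, show 2*(n+1)+1 = (2*n+1)+1+1 by ring, Nat.factorial_succ (2*n+1+1),
      Nat.factorial_succ (2*n+1), Nat.factorial_succ n]
    push_cast
    field_simp
    ring

lemma const_eq (n : ℕ) (x : ℝ) :
    ((2:ℝ) ^ (-(5:ℝ)/4) * (2*π) ^ (-(3:ℝ)/4) *
      √((Nat.factorial n : ℝ) / (π * Real.Gamma ((n:ℝ) + 3/2)))) * hR (x^2/4) n (1/2) =
    1 / √(Nat.factorial (2*n+1)) * x^(2*n) * Real.exp (-x^2/2) := by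
  have e1 : -(x^2/4)/(1/2) = -x^2/2 := by ring
  have hf : (0:ℝ) < Nat.factorial (2*n+1) := by positivity
  have hn : (0:ℝ) < Nat.factorial n := by positivity
  have s1 : √((Nat.factorial n : ℝ) / (π * Real.Gamma ((n:ℝ) + 3/2))) =
      Nat.factorial n * 2^n * 2^((1:ℝ)/2) * π^(-(3:ℝ)/4) / √(Nat.factorial (2*n+1)) := by
    rw [eq_div_iff (by positivity), ← Real.sqrt_mul' _ hf.le]
    rw [Real.sqrt_eq_iff_mul_self_eq (by rw [gamma_fact]; positivity) (by positivity), gamma_fact]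
    symm
    have a1 : (2:ℝ)^((1:ℝ)/2) * 2^((1:ℝ)/2) = 2 := by
      rw [← Real.rpow_add two_pos]; norm_num
    have a2 : π^(-(3:ℝ)/4) * π^(-(3:ℝ)/4) * (π * √π) = 1 := by
      rw [Real.sqrt_eq_rpow, ← Real.rpow_add pi_pos]
      nth_rewrite 2 [← Real.rpow_one π]
      rw [← Real.rpow_add pi_pos, ← Real.rpow_add pi_pos]; norm_num
    have hp : 0 < √π := Real.sqrt_pos.2 pi_pos
    have a3 : π^(-(3:ℝ)/4) * π^(-(3:ℝ)/4) = 1 / (π * √π) := by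
      rw [eq_div_iff (by positivity)]; exact a2
    trans (Nat.factorial n * 2^n)^2 * (2^((1:ℝ)/2) * 2^((1:ℝ)/2)) *
      (π^(-(3:ℝ)/4) * π^(-(3:ℝ)/4))
    · ring
    · rw [a1, a3]
      field_simp
      ring
  have s2 : ((1:ℝ)/2) ^ (-((n:ℝ) + 3/2)) = 2^n * 2^((3:ℝ)/2) := by
    rw [one_div, Real.inv_rpow two_pos.le, Real.rpow_neg two_pos.le, inv_inv,
      Real.rpow_add two_pos, Real.rpow_natCast]
  rw [hR, e1, s1, s2, Real.mul_rpow two_pos.le pi_pos.le]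
  have b1 : (2:ℝ) ^ (-(5:ℝ)/4) * 2 ^ (-(3:ℝ)/4) * 2^((1:ℝ)/2) * 2^((3:ℝ)/2) = 1 := by
    rw [← Real.rpow_add two_pos, ← Real.rpow_add two_pos, ← Real.rpow_add two_pos]; norm_num
  have b2 : π ^ (-(3:ℝ)/4) * π ^ (-(3:ℝ)/4) * π^((3:ℝ)/2) = 1 := by
    rw [← Real.rpow_add pi_pos, ← Real.rpow_add pi_pos]; norm_num
  have b3 : (x^2/4)^n * 2^n * 2^n = x^(2*n) := by
    rw [← mul_pow, ← mul_pow, pow_mul]; congr 1; ring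
  trans ((2:ℝ) ^ (-(5:ℝ)/4) * 2 ^ (-(3:ℝ)/4) * 2^((1:ℝ)/2) * 2^((3:ℝ)/2)) *
    (π ^ (-(3:ℝ)/4) * π ^ (-(3:ℝ)/4) * π^((3:ℝ)/2)) * ((x^2/4)^n * 2^n * 2^n) *
    ((Nat.factorial n : ℝ) / Nat.factorial n) * (1 / √(Nat.factorial (2*n+1))) * Real.exp (-x^2/2)
  · ring
  · rw [b1, b2, b3, div_self hn.ne']; ring

lemma laguerre_eq (n : ℕ) (x : ℝ) :
    laguerreHalf n x = ∑ k ∈ Finset.range (n+1), hc n k * x^k := by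
  refine Finset.sum_congr rfl fun k hk => ?_
  have h : k ≤ n := Nat.lt_succ_iff.1 (Finset.mem_range.1 hk)
  rw [hc, Nat.cast_choose ℝ h]
  have : (n.factorial:ℝ) ≠ 0 := by positivity
  field_simp

theorem fourier_transform_radial_hermite (n : ℕ) (ξ : EuclideanSpace ℝ (Fin 3)) :
    ∫ v : EuclideanSpace ℝ (Fin 3),
        (Fn n v : ℂ) * Complex.exp (-Complex.I * ((⟪v, ξ⟫ : ℝ) : ℂ)) =
      ((1 / Real.sqrt (Nat.factorial (2*n+1)) * ‖ξ‖^(2*n) * Real.exp (-‖ξ‖^2/2) : ℝ) : ℂ) := by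
  rw [← const_eq, Complex.ofReal_mul, ← main_int ξ n (1/2) (by norm_num)]
  set C : ℝ := (2:ℝ) ^ (-(5:ℝ)/4) * (2*π) ^ (-(3:ℝ)/4) *
      √((Nat.factorial n : ℝ) / (π * Real.Gamma ((n:ℝ) + 3/2))) with hC
  have e : ∀ v, (Fn n v : ℂ) * Complex.exp (-Complex.I * ((⟪v, ξ⟫ : ℝ) : ℂ)) =
      (C:ℂ) * ∑ k ∈ Finset.range (n+1), (hc n k : ℂ) * ((((1/2:ℝ)):ℂ)^k * hK ξ k (1/2) v) := by
    intro v
    have e0 : -‖v‖^2/2 = -(1/2) * ‖v‖^2 := by ring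
    rw [Fn, ← hC, laguerre_eq, e0]
    simp only [hK]
    push_cast
    rw [mul_assoc, mul_assoc, Finset.sum_mul]
    congr 1
    refine Finset.sum_congr rfl fun k _ => ?_
    rw [div_eq_mul_inv, mul_pow, one_div]
    ring
  simp_rw [e]
  rw [integral_const_mul, integral_finsetSum]
  · simp_rw [integral_const_mul]
  · intro k _
    exact ((hK_int ξ k (by norm_num)).const_mul _).const_mul _
end

section
/- Let 0 < s < 1 and let β : ℝ → ℝ be a measurable function such that for some constant c > 0 one has c·|θ|^(−1−2s) ≤ β(θ) ≤ c⁻¹·|θ|^(−1−2s) for all θ ∈ [−π/4, π/4] \ {0}. Then there exists a constant C > 0 such that for all integers n ≥ 1 and m ≥ 0, √((2n+2m+1)/((2n+1)(2m+1)))·√(C(2n+2m, 2n))·∫_{−π/4}^{π/4} β(θ)·(sin θ)^{2n}·(cos θ)^{2m} dθ ≤ C·n^{−3/4}·(1 + m/n)^s, where C(a, b) denotes the binomial coefficient a choose b. -/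
open Real MeasureTheory

/-- d_k = (2k+1) centralBinom k -/
lemma dsub (n m : ℕ) : ((2*(n+m:ℕ)+1) * (n+m).centralBinom : ℝ) ≤
    ((2*n+1) * n.centralBinom) * ((2*m+1) * m.centralBinom) := by
  induction m with
  | zero => simp
  | succ m ih =>
    have h1 : ((n+m:ℕ)+1:ℝ) * (n+(m+1)).centralBinom = 2*(2*(n+m:ℕ)+1) * (n+m).centralBinom := by
      exact_mod_cast Nat.succ_mul_centralBinom_succ (n+m)
    have h2 : ((m:ℝ)+1) * (m+1).centralBinom = 2*(2*m+1) * m.centralBinom := by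
      exact_mod_cast Nat.succ_mul_centralBinom_succ m
    have e1 : ((n+(m+1)).centralBinom:ℝ) = 2*(2*(n+m:ℕ)+1) * (n+m).centralBinom / ((n+m:ℕ)+1:ℝ) := by
      rw [← h1]; field_simp
    have e2 : ((m+1).centralBinom:ℝ) = 2*(2*m+1) * m.centralBinom / (m+1:ℝ) := by
      rw [← h2]; field_simp
    rw [e1, e2]
    push_cast at ih ⊢
    have hD : (0:ℝ) ≤ (((n+m).centralBinom : ℕ) : ℝ) := by positivity
    generalize (((n+m).centralBinom : ℕ) : ℝ) = D at *
    set E : ℝ := ((2*n+1) * n.centralBinom)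
    set F : ℝ := ((m.centralBinom : ℕ) : ℝ)
    have hE : 0 ≤ E := by positivity
    have hF : 0 ≤ F := by positivity
    have hr : (2*(2*(n+(m+1))+1) / (n+m+1) : ℝ) ≤ 2*(2*(m+1)+1)/(m+1) := by
      rw [div_le_div_iff₀ (by positivity) (by positivity)]
      have : (0:ℝ) ≤ n := by positivity
      nlinarith
    have := mul_le_mul hr ih (by positivity) (by positivity)
    calc _ = (2*(2*(n+(m+1))+1) / (n+m+1) : ℝ) * ((2 * (n + m) + 1) * D) := by ring
      _ ≤ _ := this
      _ = _ := by ring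

lemma choose_bound (n m : ℕ) :
    Real.sqrt ((2*(n:ℝ) + 2*(m:ℝ) + 1) / ((2*(n:ℝ) + 1) * (2*(m:ℝ) + 1))) *
          Real.sqrt (((2*n + 2*m).choose (2*n) : ℝ)) ≤ ((n+m).choose n : ℝ) := by
  rw [← Real.sqrt_mul (by positivity)]
  apply Real.sqrt_le_iff.mpr ⟨by positivity, ?_⟩
  have h := dsub n m
  have hc : ∀ k : ℕ, (k.centralBinom : ℝ) = ((2*k).factorial : ℝ) / (k.factorial * k.factorial) := by
    intro k
    rw [Nat.centralBinom, Nat.cast_choose ℝ (by omega)]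
    congr 3
    rw [show 2*k-k = k by omega]
  rw [hc, hc, hc] at h
  rw [Nat.cast_choose ℝ (by omega), Nat.cast_choose ℝ (by omega), show 2*n+2*m-2*n = 2*m by omega,
    show n+m-n = m by omega, show 2*n+2*m = 2*(n+m) by ring]
  push_cast at h
  have p : ∀ k : ℕ, (0:ℝ) < k.factorial := fun k => by positivity
  have p1 := p n
  have p2 := p m
  have p3 := p (n+m)
  have p4 := p (2*n)
  have p5 := p (2*m)
  have p6 := p (2*(n+m))
  have q1 : (0:ℝ) < 2*n+1 := by positivity
  have q2 : (0:ℝ) < 2*m+1 := by positivity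
  generalize ((n.factorial : ℕ):ℝ) = A at *
  generalize ((m.factorial : ℕ):ℝ) = B at *
  generalize (((n+m).factorial : ℕ):ℝ) = D at *
  generalize (((2*n).factorial : ℕ):ℝ) = A' at *
  generalize (((2*m).factorial : ℕ):ℝ) = B' at *
  generalize (((2*(n+m)).factorial : ℕ):ℝ) = D' at *
  calc _ = ((2 * (n + m) + 1) * (D' / (D * D))) * (D*D/((2*n+1)*(2*m+1)*A'*B')) := by
        field_simp
    _ ≤ ((2 * n + 1) * (A' / (A * A)) * ((2 * m + 1) * (B' / (B * B)))) * (D*D/((2*n+1)*(2*m+1)*A'*B')) := by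
        gcongr
    _ = _ := by field_simp

lemma I_int (a b : ℕ) : ∫ x in (0:ℝ)..(π/2), sin x ^ (2*a+1) * cos x ^ (2*b+1) =
    a.factorial * b.factorial / (2 * (a+b+1).factorial) := by
  induction a with
  | zero =>
    have : ∀ x ∈ Set.uIcc 0 (π/2), HasDerivAt (fun x => - cos x ^ (2*b+2) / (2*b+2)) (sin x ^ (2*0+1) * cos x ^ (2*b+1)) x := by
      intro x _
      have := (((hasDerivAt_cos x).pow (2*b+2)).neg).div_const (2*b+2:ℝ)
      refine this.congr_deriv ?_
      push_cast
      simp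
      field_simp
    rw [intervalIntegral.integral_eq_sub_of_hasDerivAt this (Continuous.intervalIntegrable (by fun_prop) _ _)]
    simp [Nat.factorial_succ]
    field_simp
  | succ a ih =>
    have : ∀ x ∈ Set.uIcc 0 (π/2), HasDerivAt (fun x => sin x ^ (2*a+2) * cos x ^ (2*b+2)) 
      ((2*a+2) * (sin x ^ (2*a+1) * cos x ^ (2*b+1)) - (2*a+2*b+4) * (sin x ^ (2*(a+1)+1) * cos x ^ (2*b+1))) x := by
      intro x _
      have := ((hasDerivAt_sin x).pow (2*a+2)).mul ((hasDerivAt_cos x).pow (2*b+2))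
      refine this.congr_deriv ?_
      push_cast
      simp only [show 2*b+2 = 2*b+1+1 by ring, show 2*(a+1)+1 = 2*a+3 by ring]
      have := sin_sq_add_cos_sq x
      have e : cos x ^2 = 1 - sin x^2 := by linarith
      calc _ = (2*a+2) * sin x ^(2*a+1) * cos x^(2*b+1) * cos x^2 - (2*b+2)*sin x ^(2*a+3) * cos x^(2*b+1) := by simp; ring
        _ = _ := by rw [e]; ring
    have h := intervalIntegral.integral_eq_sub_of_hasDerivAt this (Continuous.intervalIntegrable (by fun_prop) _ _)
    rw [intervalIntegral.integral_sub (Continuous.intervalIntegrable (by fun_prop) _ _) (Continuous.intervalIntegrable (by fun_prop) _ _),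
      intervalIntegral.integral_const_mul, intervalIntegral.integral_const_mul, ih] at h
    simp at h
    have h3 : ∫ x in (0:ℝ)..(π/2), sin x ^ (2*(a+1)+1) * cos x ^ (2*b+1) = (2*a+2) * (a.factorial * b.factorial / (2 * (a+b+1).factorial)) / (2*a+2*b+4) := by
      rw [eq_div_iff (by positivity)]; linarith
    rw [h3, show a+1+b+1 = a+b+1+1 by ring, Nat.factorial_succ a, Nat.factorial_succ (a+b+1)]
    push_cast
    field_simp
    ring

lemma k_cont (p : ℝ) (hp : 0 ≤ p) (b : ℕ) : Continuous (fun x : ℝ => sin x ^ p * cos x ^ b) :=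
  (continuous_sin.rpow_const (fun _ => Or.inr hp)).mul (by fun_prop)

lemma k_bound (s : ℝ) (hs0 : 0 < s) (hs1 : s < 1) (n m : ℕ) (hn : 1 ≤ n) :
    ∫ x in (0:ℝ)..(π/2), sin x ^ (2*n+1-2*s) * cos x ^ (2*m+1) ≤
      (1 + (m:ℝ)/n)^s / ((n+m) * ((n+m).choose n : ℝ)) := by
  obtain ⟨k, rfl⟩ : ∃ k, n = k+1 := ⟨n-1, by omega⟩
  set l : ℝ := 1 + (m:ℝ)/((k+1:ℕ):ℝ) with hl
  have hl0 : 0 < l := by positivity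
  have hpi := pi_pos
  have hk : (0:ℝ) ≤ k := by positivity
  have step : ∫ x in (0:ℝ)..(π/2), sin x ^ (2*((k+1:ℕ):ℝ)+1-2*s) * cos x ^ (2*m+1) ≤
      ∫ x in (0:ℝ)..(π/2), (l^s * (sin x ^ (2*(k+1)+1) * cos x ^ (2*m+1)) + l^s*l⁻¹ * (sin x ^ (2*k+1) * cos x ^ (2*m+1))) := by
    apply intervalIntegral.integral_mono_on_of_le_Ioo (by positivity)
    · apply (k_cont _ _ _).intervalIntegrable
      push_cast
      linarith
    · exact Continuous.intervalIntegrable (by fun_prop) _ _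
    · intro x hx
      have hsin : 0 < sin x := sin_pos_of_pos_of_lt_pi hx.1 (by linarith [hx.2])
      have hcos : 0 < cos x := cos_pos_of_mem_Ioo ⟨by linarith [hx.1], hx.2⟩
      have e1 : sin x ^ (2*((k+1:ℕ):ℝ)+1-2*s) = sin x ^ (2*k+1) * (sin x ^ 2) ^ (1-s) := by
        rw [← Real.rpow_natCast (sin x) 2, ← Real.rpow_mul hsin.le, ← Real.rpow_natCast, ← Real.rpow_add hsin]
        congr 1
        push_cast
        ring
      have y : (l * sin x^2)^(1-s) ≤ l * sin x ^2 + 1 := by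
        have hy : 0 ≤ l * sin x^2 := by positivity
        rcases le_total (l * sin x^2) 1 with h | h
        · have := Real.rpow_le_one hy h (by linarith : 0 ≤ 1-s)
          linarith
        · have := Real.rpow_le_rpow_of_exponent_le h (by linarith : 1-s ≤ 1)
          rw [Real.rpow_one] at this
          linarith
      rw [Real.mul_rpow hl0.le (by positivity), Real.rpow_sub hl0, Real.rpow_one] at y
      have hls : 0 < l^s := by positivity
      have y2 : (sin x^2)^(1-s) ≤ l^s * (sin x^2 + l⁻¹) := by
        have := mul_le_mul_of_nonneg_left y (by positivity : 0 ≤ l^s / l)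
        calc _ = l^s / l * (l / l^s * (sin x^2)^(1-s)) := by field_simp
          _ ≤ _ := this
          _ = _ := by field_simp
      rw [e1]
      calc _ ≤ sin x ^ (2*k+1) * (l^s * (sin x^2 + l⁻¹)) * cos x ^ (2*m+1) := by gcongr
        _ = _ := by ring
  refine step.trans ?_
  rw [intervalIntegral.integral_add (Continuous.intervalIntegrable (by fun_prop) _ _) (Continuous.intervalIntegrable (by fun_prop) _ _),
      intervalIntegral.integral_const_mul, intervalIntegral.integral_const_mul, I_int, I_int,
      Nat.cast_choose ℝ (by omega), show k+1+m-(k+1) = m by omega, show k+1+m = k+m+1 by ring, Nat.factorial_succ (k+m+1), Nat.factorial_succ k]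
  have hli : l⁻¹ = (k+1)/(k+m+1) := by
    rw [hl]; push_cast; field_simp; ring
  rw [hli]
  have p1 : (0:ℝ) < k.factorial := by positivity
  have p2 : (0:ℝ) < m.factorial := by positivity
  have p3 : (0:ℝ) < (k+m+1).factorial := by positivity
  have hls : 0 < l^s := by positivity
  push_cast
  have : l ^ s * ((k + 1) * k.factorial * m.factorial / (2 * ((k + m + 1 + 1) * (k + m + 1).factorial))) ≤
     l ^ s * ((k + 1) * k.factorial * m.factorial / (2 * ((k + m + 1) * (k + m + 1).factorial))) := by
    refine mul_le_mul_of_nonneg_left (div_le_div_of_nonneg_left (by positivity) (by positivity) ?_) hls.le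
    nlinarith
  refine (add_le_add_left this _).trans (le_of_eq ?_)
  field_simp
  ring

lemma G_bound (s : ℝ) (hs0 : 0 < s) (hs1 : s < 1) (n m : ℕ) (hn : 1 ≤ n) :
    IntervalIntegrable (fun x => sin x ^ (2*n-1-2*s) * cos x ^ (2*m+3)) volume 0 (π/2) ∧
    ∫ x in (0:ℝ)..(π/2), sin x ^ (2*n-1-2*s) * cos x ^ (2*m+3) ≤
      (1 + (m:ℝ)/n)^s / ((1-s) * n * ((n+m).choose n : ℝ)) := by
  have hn' : (1:ℝ) ≤ n := by exact_mod_cast hn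
  have hpi := pi_pos
  have hkc : Continuous (fun x : ℝ => sin x ^ (2*n+1-2*s) * cos x ^ (2*m+1)) := k_cont _ (by linarith) _
  set K : ℝ → ℝ := fun x => ∫ y in (0:ℝ)..x, sin y ^ (2*n+1-2*s) * cos y ^ (2*m+1) with hK
  have hKd : ∀ x, HasDerivAt K (sin x ^ (2*n+1-2*s) * cos x ^ (2*m+1)) x := fun x =>
    intervalIntegral.integral_hasDerivAt_right (hkc.intervalIntegrable _ _)
      (hkc.stronglyMeasurableAtFilter _ _) hkc.continuousAt
  set H : ℝ → ℝ := fun x => (sin x ^ (2*n-2*s) * cos x ^ (2*m+2) + (2*m+2) * K x) / (2*n-2*s) with hH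
  have hp : 0 < 2*n-2*s := by linarith
  have hHc : Continuous H := by
    have : Continuous K := continuous_iff_continuousAt.mpr fun x => (hKd x).continuousAt
    have := k_cont (2*n-2*s) hp.le (2*m+2)
    fun_prop
  have hHd : ∀ x ∈ Set.Ioo 0 (π/2), HasDerivAt H (sin x ^ (2*n-1-2*s) * cos x ^ (2*m+3)) x := by
    intro x hx
    have hsin : 0 < sin x := sin_pos_of_pos_of_lt_pi hx.1 (by linarith [hx.2])
    have h1 := ((hasDerivAt_sin x).rpow_const (p := 2*n-2*s) (Or.inl hsin.ne')).mul ((hasDerivAt_cos x).pow (2*m+2))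
    have h2 := (h1.add ((hKd x).const_mul (2*m+2:ℝ))).div_const (2*n-2*s)
    refine h2.congr_deriv ?_
    have e1 : sin x ^ (2*n+1-2*s) = sin x * sin x ^ (2*n-2*s) := by
      rw [mul_comm (sin x), ← Real.rpow_add_one hsin.ne']; congr 1; ring
    have e2 : (2*n-2*s-1 : ℝ) = 2*n-1-2*s := by ring
    rw [e1, e2]
    simp only [show 2*m+2-1 = 2*m+1 by omega, Pi.pow_apply]
    push_cast
    rw [div_eq_iff hp.ne']
    ring
  have hint : IntervalIntegrable (fun x => sin x ^ (2*n-1-2*s) * cos x ^ (2*m+3)) volume 0 (π/2) := by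
    have e : (0:ℝ) ≤ π/2 := by positivity
    apply intervalIntegral.intervalIntegrable_deriv_of_nonneg hHc.continuousOn
    · rw [min_eq_left e, max_eq_right e]; exact hHd
    · rw [min_eq_left e, max_eq_right e]
      intro x hx
      have hsin : 0 < sin x := sin_pos_of_pos_of_lt_pi hx.1 (by linarith [hx.2])
      have hcos : 0 < cos x := cos_pos_of_mem_Ioo ⟨by linarith [hx.1], hx.2⟩
      positivity
  refine ⟨hint, ?_⟩
  rw [intervalIntegral.integral_eq_sub_of_hasDerivAt_of_le (by positivity) hHc.continuousOn hHd hint]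
  have hH0 : H 0 = 0 := by
    simp [hH, hK, Real.zero_rpow hp.ne']
  have hH1 : H (π/2) = (2*m+2) * K (π/2) / (2*n-2*s) := by simp [hH]
  rw [hH0, hH1, sub_zero]
  have hb := k_bound s hs0 hs1 n m hn
  have hch : (0:ℝ) < (n+m).choose n := by exact_mod_cast Nat.choose_pos (by omega)
  have hm : (0:ℝ) ≤ m := by positivity
  have hl : 0 ≤ (1 + (m:ℝ)/n)^s := by positivity
  have h1s : 0 < 1 - s := by linarith
  calc _ ≤ (2*m+2) * ((1 + (m:ℝ)/n)^s / ((n+m) * ((n+m).choose n : ℝ))) / (2*n-2*s) := by gcongr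
    _ ≤ (2*(n+m)) * ((1 + (m:ℝ)/n)^s / ((n+m) * ((n+m).choose n : ℝ))) / (2*((1-s)*n)) := by
      gcongr ?_ * _ / ?_
      · linarith
      · nlinarith
    _ = _ := by field_simp

lemma half_bound (s : ℝ) (hs0 : 0 < s) (hs1 : s < 1) (β : ℝ → ℝ) (hβmeas : Measurable β)
    (c : ℝ) (hc : 0 < c)
    (hβ : ∀ θ ∈ Set.Ioc 0 (π/4), 0 ≤ β θ ∧ β θ ≤ c⁻¹ * θ ^ (-(1:ℝ) - 2*s)) (n m : ℕ) (hn : 1 ≤ n) :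
    IntervalIntegrable (fun θ => β θ * sin θ ^ (2*n) * cos θ ^ (2*m)) volume 0 (π/4) ∧
    ∫ θ in (0:ℝ)..(π/4), β θ * sin θ ^ (2*n) * cos θ ^ (2*m) ≤
      4 * c⁻¹ * ((1 + (m:ℝ)/n)^s / ((1-s) * n * ((n+m).choose n : ℝ))) := by
  have hpi := pi_pos
  obtain ⟨hG, hGb⟩ := G_bound s hs0 hs1 n m hn
  have hG4 : IntervalIntegrable (fun x => 4 * c⁻¹ * (sin x ^ (2*n-1-2*s) * cos x ^ (2*m+3))) volume 0 (π/4) := by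
    apply IntervalIntegrable.const_mul
    apply hG.mono_set
    rw [Set.uIcc_of_le (by positivity), Set.uIcc_of_le (by positivity)]
    exact Set.Icc_subset_Icc le_rfl (by linarith)
  have key : ∀ x ∈ Set.Ioc 0 (π/4), 0 ≤ β x * sin x ^ (2*n) * cos x ^ (2*m) ∧
      β x * sin x ^ (2*n) * cos x ^ (2*m) ≤ 4 * c⁻¹ * (sin x ^ (2*n-1-2*s) * cos x ^ (2*m+3)) := by
    intro x hx
    have hsin : 0 < sin x := sin_pos_of_pos_of_lt_pi hx.1 (by linarith [hx.2])
    have hcos : 0 < cos x := cos_pos_of_mem_Ioo ⟨by linarith [hx.1], by linarith [hx.2]⟩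
    obtain ⟨h0, h1⟩ := hβ x hx
    refine ⟨by positivity, ?_⟩
    have hc4 : √2/2 ≤ cos x := by
      rw [← cos_pi_div_four]
      exact cos_le_cos_of_nonneg_of_le_pi hx.1.le (by linarith) hx.2
    have hs2 : √2 * √2 = 2 := Real.mul_self_sqrt (by norm_num)
    have hs1' : 1 ≤ √2 := Real.one_le_sqrt.mpr (by norm_num)
    have hcc : 1/2 ≤ cos x ^ 2 := by nlinarith
    have hc3 : 1 ≤ 4 * cos x ^ 3 := by
      have : (1/2) * (1/2) ≤ cos x ^ 2 * cos x := by gcongr; linarith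
      nlinarith
    have hb : β x ≤ c⁻¹ * sin x ^ (-(1:ℝ) - 2*s) := by
      refine h1.trans (mul_le_mul_of_nonneg_left ?_ (by positivity))
      exact Real.rpow_le_rpow_of_nonpos hsin (sin_le hx.1.le) (by linarith)
    have e1 : sin x ^ (2*n-1-2*s) = sin x ^ (-(1:ℝ) - 2*s) * sin x ^ (2*n) := by
      rw [← Real.rpow_natCast, ← Real.rpow_add hsin]
      congr 1
      push_cast
      ring
    calc _ ≤ c⁻¹ * sin x ^ (-(1:ℝ) - 2*s) * sin x ^ (2*n) * cos x ^ (2*m) * 1 := by rw [mul_one]; gcongr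
      _ ≤ c⁻¹ * sin x ^ (-(1:ℝ) - 2*s) * sin x ^ (2*n) * cos x ^ (2*m) * (4 * cos x ^ 3) := by gcongr
      _ = _ := by rw [e1]; ring
  have hI : IntervalIntegrable (fun θ => β θ * sin θ ^ (2*n) * cos θ ^ (2*m)) volume 0 (π/4) := by
    apply hG4.mono_fun
    · apply Measurable.aestronglyMeasurable
      fun_prop
    · rw [Set.uIoc_of_le (by positivity)]
      refine (ae_restrict_iff' measurableSet_Ioc).mpr (Filter.Eventually.of_forall fun x hx => ?_)
      obtain ⟨h0, h1⟩ := key x hx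
      simp only [Real.norm_eq_abs]
      rw [abs_of_nonneg h0, abs_of_nonneg (h0.trans h1)]
      exact h1
  refine ⟨hI, ?_⟩
  refine (intervalIntegral.integral_mono_on_of_le_Ioo (by positivity) hI hG4
    (fun x hx => (key x ⟨hx.1, hx.2.le⟩).2)).trans ?_
  rw [intervalIntegral.integral_const_mul]
  gcongr
  refine le_trans ?_ hGb
  apply intervalIntegral.integral_mono_interval le_rfl (by positivity) (by linarith) _ hG
  refine (ae_restrict_iff' measurableSet_Ioc).mpr (Filter.Eventually.of_forall fun x hx => ?_)
  have hsin : 0 ≤ sin x := sin_nonneg_of_nonneg_of_le_pi hx.1.le (by linarith [hx.2])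
  have hcos : 0 ≤ cos x := cos_nonneg_of_mem_Icc ⟨by linarith [hx.1], by linarith [hx.2]⟩
  simp only [Pi.zero_apply]
  positivity

theorem coupling_coefficient_bound
    (s : ℝ) (hs0 : 0 < s) (hs1 : s < 1) (β : ℝ → ℝ) (hβmeas : Measurable β)
    (c : ℝ) (hc : 0 < c)
    (hβbound : ∀ θ ∈ Set.Icc (-(π/4)) (π/4), θ ≠ 0 →
      c * |θ| ^ (-(1:ℝ) - 2*s) ≤ β θ ∧ β θ ≤ c⁻¹ * |θ| ^ (-(1:ℝ) - 2*s)) :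
    ∃ C : ℝ, 0 < C ∧ ∀ n m : ℕ, 1 ≤ n →
      Real.sqrt ((2*(n:ℝ) + 2*(m:ℝ) + 1) / ((2*(n:ℝ) + 1) * (2*(m:ℝ) + 1))) *
          Real.sqrt (((2*n + 2*m).choose (2*n) : ℝ)) *
          (∫ θ in (-(π/4))..(π/4), β θ * Real.sin θ ^ (2*n) * Real.cos θ ^ (2*m)) ≤
        C * (n:ℝ) ^ (-(3:ℝ)/4) * (1 + (m:ℝ)/(n:ℝ)) ^ s := by
  have hpi := pi_pos
  have h1s : 0 < 1 - s := by linarith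
  refine ⟨8 * c⁻¹ / (1-s), by positivity, fun n m hn => ?_⟩
  have hn' : (1:ℝ) ≤ n := by exact_mod_cast hn
  obtain ⟨i1, b1⟩ := half_bound s hs0 hs1 β hβmeas c hc (fun θ hθ => by
    obtain ⟨h1, h2⟩ := hβbound θ ⟨by linarith [hθ.1], hθ.2⟩ hθ.1.ne'
    rw [abs_of_pos hθ.1] at h1 h2
    have := Real.rpow_nonneg hθ.1.le (-(1:ℝ) - 2*s)
    exact ⟨le_trans (by positivity) h1, h2⟩) n m hn
  obtain ⟨i2, b2⟩ := half_bound s hs0 hs1 (fun x => β (-x)) (hβmeas.comp measurable_neg) c hc (fun θ hθ => by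
    obtain ⟨h1, h2⟩ := hβbound (-θ) ⟨by linarith [hθ.2], by linarith [hθ.1]⟩ (neg_ne_zero.mpr hθ.1.ne')
    rw [abs_neg, abs_of_pos hθ.1] at h1 h2
    have := Real.rpow_nonneg hθ.1.le (-(1:ℝ) - 2*s)
    exact ⟨le_trans (by positivity) h1, h2⟩) n m hn
  have e2 : (fun θ => β (-θ) * Real.sin θ ^ (2*n) * Real.cos θ ^ (2*m)) =
      fun θ => (fun θ => β θ * Real.sin θ ^ (2*n) * Real.cos θ ^ (2*m)) (-θ) := by
    funext θ
    simp only [Real.sin_neg, Real.cos_neg]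
    rw [Even.neg_pow (even_two_mul n)]
  have i3 : IntervalIntegrable (fun θ => β θ * Real.sin θ ^ (2*n) * Real.cos θ ^ (2*m)) volume (-(π/4)) 0 := by
    rw [IntervalIntegrable.iff_comp_neg, ← e2, neg_neg, neg_zero]
    exact i2.symm
  rw [e2, intervalIntegral.integral_comp_neg (fun θ => β θ * Real.sin θ ^ (2*n) * Real.cos θ ^ (2*m)), neg_zero] at b2
  have hsum := intervalIntegral.integral_add_adjacent_intervals i3 i1
  have hch : (0:ℝ) < (n+m).choose n := by exact_mod_cast Nat.choose_pos (by omega)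
  have hl : 0 ≤ (1 + (m:ℝ)/n)^s := by positivity
  have hI : (∫ θ in (-(π/4))..(π/4), β θ * Real.sin θ ^ (2*n) * Real.cos θ ^ (2*m)) ≤
      8 * c⁻¹ * ((1 + (m:ℝ)/n)^s / ((1-s) * n * ((n+m).choose n : ℝ))) := by
    rw [← hsum]; linarith
  have hnn : (n:ℝ)⁻¹ ≤ (n:ℝ) ^ (-(3:ℝ)/4) := by
    rw [← Real.rpow_neg_one]
    exact Real.rpow_le_rpow_of_exponent_le hn' (by norm_num)
  calc _ ≤ Real.sqrt ((2*(n:ℝ) + 2*(m:ℝ) + 1) / ((2*(n:ℝ) + 1) * (2*(m:ℝ) + 1))) *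
          Real.sqrt (((2*n + 2*m).choose (2*n) : ℝ)) * (8 * c⁻¹ * ((1 + (m:ℝ)/n)^s / ((1-s) * n * ((n+m).choose n : ℝ)))) := by gcongr
    _ ≤ ((n+m).choose n : ℝ) * (8 * c⁻¹ * ((1 + (m:ℝ)/n)^s / ((1-s) * n * ((n+m).choose n : ℝ)))) := by
      gcongr
      exact choose_bound n m
    _ = 8 * c⁻¹ / (1-s) * (n:ℝ)⁻¹ * (1 + (m:ℝ)/n)^s := by field_simp
    _ ≤ _ := by gcongr
end

section
/- Let 0 < s < 1 and let β : ℝ → ℝ be a measurable function such that for some constant c > 0 one has c·|θ|^(−1−2s) ≤ β(θ) ≤ c⁻¹·|θ|^(−1−2s) for all θ ∈ [−π/4, π/4] \ {0}. For each integer n ≥ 1 set λ_{2n} = ∫_{−π/4}^{π/4} β(θ)·(1 − (cos θ)^{2n} − (sin θ)^{2n}) dθ, and for integers k, l ≥ 1 set c_{k,l} = √((2k+2l+1)/((2k+1)(2l+1)))·√(C(2k+2l, 2k))·∫_{−π/4}^{π/4} β(θ)·(sin θ)^{2k}·(cos θ)^{2l} dθ. Then there exists ε₀ > 0 such that for every ε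 with 0 < ε ≤ ε₀ and every family of differentiable functions b_n : [0, ∞) → ℝ (n ≥ 0) with b_0 ≡ 0, b_1 ≡ 0, satisfying for all n ≥ 2 and t ≥ 0 the differential equations b_n'(t) + λ_{2n}·b_n(t) = Σ_{k+l=n, k≥1, l≥1} c_{k,l}·b_k(t)·b_l(t), the following holds: if Σ_{n≥2} b_n(0)² ≤ ε², then for every integer N ≥ 2 and every t ≥ 0, Σ_{n=2}^{N} e^{λ_{2n}t}·b_n(t)² ≤ ε². -/
open Real MeasureTheory

lemma aux_shift (f : ℕ → ℝ) (h0 : f 0 = 0) (hf : ∀ n, 0 ≤ f n) (k M : ℕ) :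
    ∑ n ∈ Finset.range M, f (n - k) ≤ ∑ n ∈ Finset.range M, f n := by
  have h : ∀ M, ∑ n ∈ Finset.range M, f (n - k) = ∑ n ∈ Finset.range (M - k), f n := by
    intro M
    induction M with
    | zero => simp
    | succ M ih =>
      rw [Finset.sum_range_succ, ih]
      by_cases hk : k ≤ M
      · rw [Nat.succ_sub hk, Finset.sum_range_succ]
      · have h1 : M - k = 0 := by omega
        have h2 : M + 1 - k = 0 := by omega
        simp [h1, h2, h0]
  rw [h]
  exact Finset.sum_le_sum_of_subset_of_nonneg (Finset.range_mono (Nat.sub_le _ _))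
    (fun i _ _ => hf i)

/-- discrete trilinear estimate -/
lemma aux_tri (w y z : ℕ → ℝ) (hw : ∀ n, 0 ≤ w n) (hy : ∀ n, 0 ≤ y n) (hz : ∀ n, 0 ≤ z n)
    (hz0 : z 0 = 0) (hz1 : z 1 = 0) (hy1 : y 1 = 0) (W : ℝ)
    (hW : ∀ N, ∑ k ∈ Finset.Icc 2 N, w k ^ 2 ≤ W) (N : ℕ) :
    ∑ n ∈ Finset.Icc 2 N, ∑ k ∈ Finset.Icc 1 (n-1), w k * y k * z (n-k) * z n ≤
      √W * √(∑ n ∈ Finset.Icc 2 N, y n ^ 2) * ∑ n ∈ Finset.Icc 2 N, z n ^ 2 := by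
  have hS : ∑ n ∈ Finset.range (N+1), z n ^ 2 = ∑ n ∈ Finset.Icc 2 N, z n ^ 2 := by
    symm
    apply Finset.sum_subset
    · intro i hi; simp at *; omega
    · intro i hi hi'
      have : i = 0 ∨ i = 1 := by simp at *; omega
      rcases this with rfl | rfl <;> simp [hz0, hz1]
  have step1 : ∑ n ∈ Finset.Icc 2 N, ∑ k ∈ Finset.Icc 1 (n-1), w k * y k * z (n-k) * z n ≤
      ∑ n ∈ Finset.range (N+1), ∑ k ∈ Finset.Icc 2 N, w k * y k * z (n-k) * z n := by
    have hnn : ∀ n k, 0 ≤ w k * y k * z (n-k) * z n := fun n k =>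
      mul_nonneg (mul_nonneg (mul_nonneg (hw _) (hy _)) (hz _)) (hz _)
    refine (Finset.sum_le_sum (g := fun n => ∑ k ∈ Finset.Icc 2 N, w k * y k * z (n-k) * z n) ?_).trans
      (Finset.sum_le_sum_of_subset_of_nonneg ?_ ?_)
    · intro n hn
      have hn' := Finset.mem_Icc.1 hn
      have : ∑ k ∈ Finset.Icc 1 (n-1), w k * y k * z (n-k) * z n
          = ∑ k ∈ Finset.Icc 2 (n-1), w k * y k * z (n-k) * z n := by
        symm
        apply Finset.sum_subset
        · intro i hi; simp at *; omega
        · intro i hi hi'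
          have : i = 1 := by simp at *; omega
          subst this; simp [hy1]
      rw [this]
      exact Finset.sum_le_sum_of_subset_of_nonneg
        (Finset.Icc_subset_Icc_right (by omega)) (fun k _ _ => hnn n k)
    · intro i hi; simp at *; omega
    · intro n _ _; exact Finset.sum_nonneg (fun k _ => hnn n k)
  refine step1.trans ?_
  rw [Finset.sum_comm]
  have hzz : ∀ k, ∑ n ∈ Finset.range (N+1), z (n-k) * z n ≤ ∑ n ∈ Finset.Icc 2 N, z n ^ 2 := by
    intro k
    have h1 := aux_shift (fun n => z n ^ 2) (by simp [hz0]) (fun n => sq_nonneg _) k (N+1)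
    have h2 : ∑ n ∈ Finset.range (N+1), z (n-k) * z n ≤
        ∑ n ∈ Finset.range (N+1), ((1/2) * z (n-k)^2 + (1/2) * z n ^2) :=
      Finset.sum_le_sum (fun n _ => by nlinarith [sq_nonneg (z (n-k) - z n)])
    rw [Finset.sum_add_distrib, ← Finset.mul_sum, ← Finset.mul_sum] at h2
    linarith
  have hD : 0 ≤ ∑ n ∈ Finset.Icc 2 N, z n ^ 2 := Finset.sum_nonneg (fun _ _ => sq_nonneg _)
  calc ∑ k ∈ Finset.Icc 2 N, ∑ n ∈ Finset.range (N+1), w k * y k * z (n-k) * z n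
      = ∑ k ∈ Finset.Icc 2 N, w k * y k * ∑ n ∈ Finset.range (N+1), z (n-k) * z n := by
        refine Finset.sum_congr rfl (fun k _ => ?_)
        rw [Finset.mul_sum]
        exact Finset.sum_congr rfl (fun n _ => by ring)
    _ ≤ ∑ k ∈ Finset.Icc 2 N, w k * y k * ∑ n ∈ Finset.Icc 2 N, z n ^ 2 :=
        Finset.sum_le_sum (fun k _ => mul_le_mul_of_nonneg_left (hzz k) (mul_nonneg (hw _) (hy _)))
    _ = (∑ k ∈ Finset.Icc 2 N, w k * y k) * ∑ n ∈ Finset.Icc 2 N, z n ^ 2 := by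
        rw [Finset.sum_mul]
    _ ≤ _ := by
        apply mul_le_mul_of_nonneg_right _ hD
        refine (Real.sum_mul_le_sqrt_mul_sqrt _ _ _).trans ?_
        exact mul_le_mul_of_nonneg_right (Real.sqrt_le_sqrt (hW N)) (Real.sqrt_nonneg _)

lemma aux_binom1 (p q : ℝ) (hp : 0 ≤ p) (hq : 0 ≤ q) (h : p + q = 1) (i j : ℕ) :
    ((i + j).choose i : ℝ) * (p ^ i * q ^ j) ≤ 1 := by
  have h1 := add_pow p q (i+j)
  rw [h, one_pow] at h1
  rw [h1]
  have := Finset.single_le_sum (f := fun m => p ^ m * q ^ (i + j - m) * ((i + j).choose m : ℝ))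
    (s := Finset.range (i+j+1)) (fun m _ => by positivity) (show i ∈ Finset.range (i+j+1) by simp)
  simp only [Nat.add_sub_cancel_left] at this
  linarith

lemma aux_binom2 (p q : ℝ) (hp : 0 ≤ p) (hq : 0 ≤ q) (h : p + q = 1) (i j : ℕ) :
    ((i + 2 + j).choose (i+2) : ℝ) * (p ^ (i+2) * q ^ j) * ((i+2) * (i+1)) ≤
      (i+j+2)*(i+j+1) * p ^ 2 := by
  have h1 := Nat.add_one_mul_choose_eq (i+j+1) (i+1)
  have h2 := Nat.add_one_mul_choose_eq (i+j) i
  have e : i + 2 + j = (i+j+1).succ := by omega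
  rw [e]
  have h1' : ((i:ℝ)+j+1+1) * ((i+j+1).choose (i+1) : ℝ) = ((i+j+1).succ.choose (i+2) : ℝ) * (i+1+1) := by
    exact_mod_cast h1
  have h2' : ((i:ℝ)+j+1) * ((i+j).choose i : ℝ) = ((i+j+1).choose (i+1) : ℝ) * (i+1) := by
    exact_mod_cast h2
  have h3 := aux_binom1 p q hp hq h i j
  have : ((i+j+1).succ.choose (i+2) : ℝ) * (p ^ (i+2) * q ^ j) * ((i+2) * (i+1)) =
    ((i:ℝ)+j+2)*(i+j+1) * p^2 * (((i + j).choose i : ℝ) * (p ^ i * q ^ j)) := by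
    have e1 : ((i+j+1).succ.choose (i+2) : ℝ) * ((i+2) * (i+1)) = (i+j+2)*(i+j+1)*((i + j).choose i : ℝ) := by
      linear_combination (-(i:ℝ)-1) * h1' - (i+j+2) * h2'
    linear_combination (p ^ (i+2) * q ^ j) * e1
  rw [this]
  exact mul_le_of_le_one_right (by positivity) h3

lemma aux_binom3 (θ : ℝ) (k l : ℕ) (hk : 1 ≤ k) :
    √((2*k+2*l).choose (2*k) : ℝ) * |sin θ ^ (2*k) * cos θ ^ (2*l)| ≤
      min 1 (2 * ((k:ℝ)+l) / k * θ ^ 2) := by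
  have hkr : (1:ℝ) ≤ k := by exact_mod_cast hk
  have hpq : sin θ ^ 2 + cos θ ^ 2 = 1 := sin_sq_add_cos_sq θ
  have hsq : (√((2*k+2*l).choose (2*k) : ℝ) * |sin θ ^ (2*k) * cos θ ^ (2*l)|)^2 =
    ((2*k+2*l).choose (2*k) : ℝ) * ((sin θ ^ 2)^(2*k) * (cos θ ^ 2)^(2*l)) := by
    rw [mul_pow, Real.sq_sqrt (by positivity), sq_abs]; ring
  apply le_min
  · refine (abs_le_of_sq_le_sq' ?_ zero_le_one).2
    rw [hsq, one_pow]
    exact aux_binom1 _ _ (sq_nonneg _) (sq_nonneg _) hpq _ _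
  · refine (abs_le_of_sq_le_sq' ?_ (by positivity)).2
    rw [hsq]
    obtain ⟨m, rfl⟩ : ∃ m, k = m + 1 := ⟨k-1, by omega⟩
    have h := aux_binom2 _ _ (sq_nonneg (sin θ)) (sq_nonneg (cos θ)) hpq (2*m) (2*l)
    have e : 2 * (m+1) = 2*m+2 := by ring
    rw [e]
    have hs : sin θ ^ 2 ≤ θ ^ 2 := by
      rw [← sq_abs (sin θ), ← sq_abs θ]
      exact pow_le_pow_left₀ (abs_nonneg _) (abs_sin_le_abs) 2
    set P := ((2*m+2+2*l).choose (2*m+2) : ℝ) * ((sin θ ^ 2)^(2*m+2) * (cos θ ^ 2)^(2*l)) with hP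
    have hP0 : 0 ≤ P := by positivity
    push_cast at h ⊢
    have hs2 : (sin θ ^ 2)^2 ≤ (θ^2)^2 := pow_le_pow_left₀ (sq_nonneg _) hs 2
    have hm : (0:ℝ) ≤ m := by positivity
    have hl : (0:ℝ) ≤ l := by positivity
    have key : P * ((m:ℝ)+1)^2 ≤ (2 * ((m:ℝ)+1+l))^2 * (θ^2)^2 := by
      calc P * ((m:ℝ)+1)^2 ≤ P * ((2 * (m:ℝ) + 2) * (2 * m + 1)) := by
            apply mul_le_mul_of_nonneg_left _ hP0; nlinarith
        _ ≤ _ := h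
        _ ≤ (2 * ((m:ℝ)+1+l))^2 * (sin θ^2)^2 := by
            apply mul_le_mul_of_nonneg_right _ (by positivity); nlinarith
        _ ≤ _ := mul_le_mul_of_nonneg_left hs2 (by positivity)
    rw [mul_pow, div_pow, div_mul_eq_mul_div, le_div_iff₀ (by positivity)]
    exact key

noncomputable def gg (s θ : ℝ) : ℝ := |θ| ^ (-(1:ℝ) - 2*s) * min 1 (θ^2)

lemma gg_nonneg (s θ : ℝ) : 0 ≤ gg s θ := by unfold gg; positivity

lemma gg_int (s : ℝ) (hs0 : 0 < s) (hs1 : s < 1) : Integrable (gg s) := by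
  have h1 : IntegrableOn (fun x : ℝ => x ^ (-(1:ℝ) - 2*s) * min 1 (x^2)) (Set.Ioi 0) := by
    rw [← Set.Ioc_union_Ioi_eq_Ioi (zero_le_one (α := ℝ))]
    apply IntegrableOn.union
    · have h := (intervalIntegral.intervalIntegrable_rpow' (a := 0) (b := 1) (r := 1 - 2*s) (by linarith))
      rw [intervalIntegrable_iff_integrableOn_Ioc_of_le zero_le_one] at h
      refine h.congr_fun ?_ measurableSet_Ioc
      intro x hx
      have hx1 : x^2 ≤ 1 := by nlinarith [hx.1, hx.2]
      simp only
      rw [min_eq_right hx1, ← Real.rpow_natCast x 2, ← Real.rpow_add hx.1]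
      congr 1; push_cast; ring
    · have h := integrableOn_Ioi_rpow_of_lt (a := -1 - 2*s) (by linarith) zero_lt_one
      refine h.congr_fun ?_ measurableSet_Ioi
      intro x hx
      have hx' : 1 < x := hx
      have hx1 : 1 ≤ x^2 := by nlinarith
      simp only
      rw [min_eq_left hx1, mul_one]
  have h2 : IntegrableOn (gg s) (Set.Ioi 0) := by
    refine h1.congr_fun ?_ measurableSet_Ioi
    intro x hx
    have hx' : 0 < x := hx
    simp only [gg, abs_of_pos hx']
  have h3 : IntegrableOn (gg s) (Set.Iic 0) := by
    rw [← Measure.map_neg_eq_self (volume : Measure ℝ)]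
    let m : MeasurableEmbedding fun x : ℝ => -x := (Homeomorph.neg ℝ).measurableEmbedding
    rw [m.integrableOn_map_iff]
    have : gg s ∘ (fun x : ℝ => -x) = gg s := by
      funext x; simp [gg]
    rw [this]
    simp only [Set.neg_preimage, Set.neg_Iic, neg_zero]
    exact (integrableOn_Ici_iff_integrableOn_Ioi (by simp)).2 h2
  have h4 := h3.union h2
  rwa [Set.Iic_union_Ioi, integrableOn_univ] at h4

lemma gg_scale (s θ M : ℝ) (hM : 0 < M) :
    |θ| ^ (-(1:ℝ) - 2*s) * min 1 (M * θ^2) = (√M) ^ (1 + 2*s) * gg s (√M * θ) := by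
  have h : 0 < √M := Real.sqrt_pos.2 hM
  unfold gg
  rw [abs_mul, abs_of_pos h, Real.mul_rpow h.le (abs_nonneg _), mul_pow, Real.sq_sqrt hM.le]
  have : (√M) ^ (1 + 2*s) * (√M) ^ (-(1:ℝ) - 2*s) = 1 := by
    rw [← Real.rpow_add h]; simp
  linear_combination (-(|θ| ^ (-(1:ℝ) - 2*s) * min 1 (M * θ^2))) * this

lemma gg_scale_int (s M : ℝ) (hs0 : 0 < s) (hs1 : s < 1) (hM : 0 < M) :
    Integrable (fun θ : ℝ => |θ| ^ (-(1:ℝ) - 2*s) * min 1 (M * θ^2)) := by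
  simp_rw [gg_scale s _ M hM]
  exact ((gg_int s hs0 hs1).comp_mul_left' (Real.sqrt_pos.2 hM).ne').const_mul _

lemma gg_scale_bound (s M : ℝ) (hs0 : 0 < s) (hs1 : s < 1) (hM : 0 < M) :
    ∫ θ in (-(π/4))..(π/4), |θ| ^ (-(1:ℝ) - 2*s) * min 1 (M * θ^2) ≤
      M ^ s * ∫ θ, gg s θ := by
  have h : 0 < √M := Real.sqrt_pos.2 hM
  rw [intervalIntegral.integral_of_le (by linarith [pi_pos])]
  refine (setIntegral_le_integral (gg_scale_int s M hs0 hs1 hM)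
    (Filter.Eventually.of_forall fun θ => ?_)).trans (le_of_eq ?_)
  · simp only [Pi.zero_apply]; positivity
  · simp_rw [gg_scale s _ M hM]
    rw [integral_const_mul, Measure.integral_comp_mul_left, abs_of_pos (by positivity), smul_eq_mul,
      ← mul_assoc]
    congr 1
    rw [← Real.rpow_neg_one, ← Real.rpow_add h, Real.sqrt_eq_rpow, ← Real.rpow_mul hM.le]
    congr 1; ring

section
variable {s c : ℝ} {β : ℝ → ℝ}

lemma beta_bound (_hs0 : 0 < s) (hc : 0 < c)
    (hβ : ∀ θ ∈ Set.Icc (-(π/4)) (π/4), θ ≠ 0 →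
      c * |θ| ^ (-(1:ℝ) - 2*s) ≤ β θ ∧ β θ ≤ c⁻¹ * |θ| ^ (-(1:ℝ) - 2*s))
    {θ : ℝ} (hθ : θ ∈ Set.Icc (-(π/4)) (π/4)) (h0 : θ ≠ 0) :
    0 ≤ β θ ∧ |β θ| ≤ c⁻¹ * |θ| ^ (-(1:ℝ) - 2*s) := by
  have h := hβ θ hθ h0
  have h1 : 0 ≤ β θ := le_trans (by positivity) h.1
  exact ⟨h1, by rw [abs_of_nonneg h1]; exact h.2⟩

lemma lam_integrable (hs0 : 0 < s) (hs1 : s < 1) (hm : Measurable β) (hc : 0 < c)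
    (hβ : ∀ θ ∈ Set.Icc (-(π/4)) (π/4), θ ≠ 0 →
      c * |θ| ^ (-(1:ℝ) - 2*s) ≤ β θ ∧ β θ ≤ c⁻¹ * |θ| ^ (-(1:ℝ) - 2*s)) (n : ℕ) (hn : 1 ≤ n) :
    IntegrableOn (fun θ => β θ * (1 - cos θ ^ (2*n) - sin θ ^ (2*n)))
      (Set.Ioc (-(π/4)) (π/4)) := by
  have hnr : (1:ℝ) ≤ n := by exact_mod_cast hn
  have hg := ((gg_scale_int s (n+1) hs0 hs1 (by positivity)).const_mul c⁻¹).integrableOn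
    (s := Set.Ioc (-(π/4)) (π/4))
  refine Integrable.mono' hg (by fun_prop) ?_
  have hne : ∀ᵐ θ : ℝ, θ ≠ 0 := by simp [ae_iff]
  filter_upwards [ae_restrict_mem measurableSet_Ioc, ae_restrict_of_ae hne] with θ hθ h0
  have hb := beta_bound hs0 hc hβ ⟨hθ.1.le, hθ.2⟩ h0
  rw [norm_mul, ← mul_assoc, Real.norm_eq_abs, Real.norm_eq_abs]
  apply mul_le_mul hb.2 _ (abs_nonneg _) (by positivity)
  have hpq : sin θ ^ 2 + cos θ ^ 2 = 1 := sin_sq_add_cos_sq θ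
  rw [pow_mul, pow_mul]
  have hs : sin θ ^ 2 ≤ θ ^ 2 := by
    rw [← sq_abs (sin θ), ← sq_abs θ]
    exact pow_le_pow_left₀ (abs_nonneg _) (abs_sin_le_abs) 2
  set p := sin θ ^ 2
  set q := cos θ ^ 2
  have hp : 0 ≤ p := sq_nonneg _
  have hq : 0 ≤ q := sq_nonneg _
  have hp1 : p ^ n ≤ p := pow_le_of_le_one hp (by linarith) (by omega)
  have hq1 : q ^ n ≤ q := pow_le_of_le_one hq (by linarith) (by omega)
  have hpn : 0 ≤ p ^ n := by positivity
  have hqn : 0 ≤ q ^ n := by positivity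
  have hbern := one_add_mul_le_pow (a := -p) (by linarith) n
  have : (1 + -p) = q := by linarith
  rw [this] at hbern
  rw [abs_of_nonneg (by linarith)]
  apply le_min
  · linarith
  · nlinarith

lemma lam_subadd (hs0 : 0 < s) (hs1 : s < 1) (hm : Measurable β) (hc : 0 < c)
    (hβ : ∀ θ ∈ Set.Icc (-(π/4)) (π/4), θ ≠ 0 →
      c * |θ| ^ (-(1:ℝ) - 2*s) ≤ β θ ∧ β θ ≤ c⁻¹ * |θ| ^ (-(1:ℝ) - 2*s)) (k l : ℕ)
    (hk : 2 ≤ k) (hl : 2 ≤ l) :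
    ∫ θ in (-(π/4))..(π/4), β θ * (1 - cos θ ^ (2*(k+l)) - sin θ ^ (2*(k+l))) ≤
    (∫ θ in (-(π/4))..(π/4), β θ * (1 - cos θ ^ (2*k) - sin θ ^ (2*k))) +
    ∫ θ in (-(π/4))..(π/4), β θ * (1 - cos θ ^ (2*l) - sin θ ^ (2*l)) := by
  have hle : -(π/4) ≤ π/4 := by linarith [pi_pos]
  rw [intervalIntegral.integral_of_le hle, intervalIntegral.integral_of_le hle,
    intervalIntegral.integral_of_le hle]
  have I := lam_integrable hs0 hs1 hm hc hβ
  have hadd := integral_add (I k (by omega)) (I l (by omega))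
  rw [← hadd]
  apply integral_mono_ae (I (k+l) (by omega)) ((I k (by omega)).add (I l (by omega)))
  have hne : ∀ᵐ θ : ℝ, θ ≠ 0 := by simp [ae_iff]
  filter_upwards [ae_restrict_mem measurableSet_Ioc, ae_restrict_of_ae hne] with θ hθ h0
  have hb := (beta_bound hs0 hc hβ ⟨hθ.1.le, hθ.2⟩ h0).1
  simp only [Pi.add_apply]
  rw [← mul_add]
  apply mul_le_mul_of_nonneg_left _ hb
  have hpq : sin θ ^ 2 + cos θ ^ 2 = 1 := sin_sq_add_cos_sq θ
  simp only [pow_mul, pow_add, mul_add]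
  set p := sin θ ^ 2
  set q := cos θ ^ 2
  have hp : 0 ≤ p := sq_nonneg _
  have hq : 0 ≤ q := sq_nonneg _
  have pk : p ^ k ≤ p^2 := pow_le_pow_of_le_one hp (by linarith) hk
  have pl : p ^ l ≤ p^2 := pow_le_pow_of_le_one hp (by linarith) hl
  have qk : q ^ k ≤ q^2 := pow_le_pow_of_le_one hq (by linarith) hk
  have ql : q ^ l ≤ q^2 := pow_le_pow_of_le_one hq (by linarith) hl
  have p2 : p^2 ≤ 1 := pow_le_one₀ hp (by linarith)
  have q2 : q^2 ≤ 1 := pow_le_one₀ hq (by linarith)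
  have A : (1 - p^2)*(1-p^2) ≤ (1-p^k)*(1-p^l) :=
    mul_le_mul (by linarith) (by linarith) (by linarith) (by linarith)
  have B : (1 - q^2)*(1-q^2) ≤ (1-q^k)*(1-q^l) :=
    mul_le_mul (by linarith) (by linarith) (by linarith) (by linarith)
  have C : (1 - p^2)*(1-p^2) + (1 - q^2)*(1-q^2) = 1 + 2 * (p*q)^2 := by
    have : q = 1 - p := by linarith
    rw [this]; ring
  nlinarith [sq_nonneg (p*q)]

lemma lam_lower (hs0 : 0 < s) (hs1 : s < 1) (hm : Measurable β) (hc : 0 < c)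
    (hβ : ∀ θ ∈ Set.Icc (-(π/4)) (π/4), θ ≠ 0 →
      c * |θ| ^ (-(1:ℝ) - 2*s) ≤ β θ ∧ β θ ≤ c⁻¹ * |θ| ^ (-(1:ℝ) - 2*s)) :
    ∃ c0 > 0, ∀ n : ℕ, 2 ≤ n → c0 * (n:ℝ)^s ≤
      ∫ θ in (-(π/4))..(π/4), β θ * (1 - cos θ ^ (2*n) - sin θ ^ (2*n)) := by
  refine ⟨c * (1/512) * (1/2), by positivity, fun n hn => ?_⟩
  have hle : -(π/4) ≤ π/4 := by linarith [pi_pos]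
  have hpi := pi_gt_three
  have hpi4 := pi_le_four
  have hn2 : (2:ℝ) ≤ n := by exact_mod_cast hn
  rw [intervalIntegral.integral_of_le hle]
  have I := lam_integrable hs0 hs1 hm hc hβ n (by omega)
  have hsn : 0 < √(n:ℝ) := Real.sqrt_pos.2 (by linarith)
  have hsn1 : 1 ≤ √(n:ℝ) := Real.one_le_sqrt.2 (by linarith)
  set u : ℝ := (√(n:ℝ))⁻¹ / 2 with hu
  have hu0 : 0 < u := by positivity
  have hu1 : u ≤ 1/2 := by
    have := inv_le_one_of_one_le₀ hsn1
    linarith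
  have hun : n * u^2 = 1/4 := by
    rw [hu, div_pow, inv_pow, Real.sq_sqrt (by linarith)]
    field_simp; norm_num
  have hsub : Set.Ioc (u/2) u ⊆ Set.Ioc (-(π/4)) (π/4) := by
    intro x hx; exact ⟨by linarith [hx.1], by linarith [hx.2]⟩
  have hne : ∀ᵐ θ : ℝ, θ ≠ 0 := by simp [ae_iff]
  have h1 : ∫ θ in Set.Ioc (u/2) u, β θ * (1 - cos θ ^ (2*n) - sin θ ^ (2*n)) ≤
      ∫ θ in Set.Ioc (-(π/4)) (π/4), β θ * (1 - cos θ ^ (2*n) - sin θ ^ (2*n)) := by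
    apply setIntegral_mono_set I _ (Filter.Eventually.of_forall hsub)
    filter_upwards [ae_restrict_mem measurableSet_Ioc, ae_restrict_of_ae hne] with θ hθ h0
    have hb := (beta_bound hs0 hc hβ ⟨hθ.1.le, hθ.2⟩ h0).1
    apply mul_nonneg hb
    have hpq : sin θ ^ 2 + cos θ ^ 2 = 1 := sin_sq_add_cos_sq θ
    rw [pow_mul, pow_mul]
    have hp1 : (sin θ ^ 2) ^ n ≤ sin θ ^ 2 :=
      pow_le_of_le_one (sq_nonneg _) (by nlinarith [sq_nonneg (cos θ)]) (by omega)
    have hq1 : (cos θ ^ 2) ^ n ≤ cos θ ^ 2 :=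
      pow_le_of_le_one (sq_nonneg _) (by nlinarith [sq_nonneg (sin θ)]) (by omega)
    linarith
  refine le_trans ?_ h1
  have h2 : ∫ θ in Set.Ioc (u/2) u, (c * u ^ (-(1:ℝ) - 2*s) * (1/512)) ≤
      ∫ θ in Set.Ioc (u/2) u, β θ * (1 - cos θ ^ (2*n) - sin θ ^ (2*n)) := by
    apply setIntegral_mono_on (integrableOn_const (by simp)) (I.mono_set hsub) measurableSet_Ioc
    intro θ hθ
    have hθ0 : 0 < θ := by linarith [hθ.1]
    have hb := (hβ θ ⟨(hsub hθ).1.le, (hsub hθ).2⟩ hθ0.ne').1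
    have hb' : c * u ^ (-(1:ℝ) - 2*s) ≤ β θ := by
      refine le_trans (mul_le_mul_of_nonneg_left ?_ hc.le) hb
      rw [abs_of_pos hθ0]
      exact Real.rpow_le_rpow_of_nonpos hθ0 hθ.2 (by linarith)
    apply mul_le_mul hb' _ (by norm_num) (le_trans (by positivity) hb')
    have hpq : sin θ ^ 2 + cos θ ^ 2 = 1 := sin_sq_add_cos_sq θ
    have hsin : θ / 2 ≤ sin θ := by
      refine le_trans ?_ (mul_le_sin hθ0.le (by linarith [hθ.2]))
      have : 1/2 ≤ 2/π := by rw [div_le_div_iff₀ (by norm_num) (by linarith)]; linarith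
      nlinarith
    have hsin' : sin θ ≤ 1/2 := (sin_le hθ0.le).trans (by linarith [hθ.2])
    rw [pow_mul, pow_mul]
    have hpu : u^2/16 ≤ sin θ ^ 2 := by nlinarith [hθ.1]
    have hp4 : sin θ ^2 ≤ 1/4 := by nlinarith [hθ.1]
    set p := sin θ ^ 2
    set q := cos θ ^ 2
    have hp : 0 ≤ p := sq_nonneg _
    have hq : 0 ≤ q := sq_nonneg _
    obtain ⟨m, rfl⟩ : ∃ m, n = m + 1 := ⟨n-1, by omega⟩
    have hm1 : (1:ℝ) ≤ m := by push_cast at hn2; linarith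
    have hp1 : p ^ (m+1) ≤ p := pow_le_of_le_one hp (by linarith) (by omega)
    have hx : (1/128:ℝ) ≤ m * p := by
      push_cast at hun
      nlinarith
    have hbern := one_add_mul_le_pow (a := p) (by linarith) m
    have hqm0 : 0 ≤ q ^ m := by positivity
    have hprod : (1+p)^m * q^m ≤ 1 := by
      rw [← mul_pow]
      apply pow_le_one₀ (by positivity)
      nlinarith
    have hqm : q ^ m * (1 + 1/128) ≤ 1 := by
      refine le_trans ?_ hprod
      rw [mul_comm]
      exact mul_le_mul_of_nonneg_right (by linarith) hqm0
    have hq34 : 3/4 ≤ q := by linarith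
    rw [pow_succ q]
    nlinarith
  refine le_trans ?_ h2
  · rw [setIntegral_const, measureReal_def, Real.volume_Ioc, ENNReal.toReal_ofReal (by linarith), smul_eq_mul]
    have e : u ^ (-(1:ℝ) - 2*s) * u = u ^ (-(2*s)) := by
      rw [← Real.rpow_add_one hu0.ne']; congr 1; ring
    have e2 : (n:ℝ)^s ≤ u ^ (-(2*s)) := by
      rw [show -(2*s) = (2:ℕ) * (-s) by push_cast; ring, Real.rpow_mul hu0.le, Real.rpow_natCast,
        Real.rpow_neg (by positivity), ← Real.inv_rpow (by positivity)]
      apply Real.rpow_le_rpow (by positivity) _ hs0.le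
      rw [le_inv_comm₀ (by linarith) (by positivity)]
      rw [← one_div, le_div_iff₀ (by linarith)]
      linarith
    calc c * (1/512) * (1/2) * (n:ℝ)^s ≤ c * (1/512) * (1/2) * u ^ (-(2*s)) := by gcongr
      _ = _ := by rw [← e]; ring

lemma cc_bound1 (hs0 : 0 < s) (hs1 : s < 1) (hc : 0 < c)
    (hβ : ∀ θ ∈ Set.Icc (-(π/4)) (π/4), θ ≠ 0 →
      c * |θ| ^ (-(1:ℝ) - 2*s) ≤ β θ ∧ β θ ≤ c⁻¹ * |θ| ^ (-(1:ℝ) - 2*s)) (k l : ℕ) (hk : 1 ≤ k) :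
    |√((2*k+2*l).choose (2*k) : ℝ) *
      ∫ θ in (-(π/4))..(π/4), β θ * sin θ ^ (2*k) * cos θ ^ (2*l)| ≤
      c⁻¹ * (∫ θ, gg s θ) * (2 * ((k:ℝ)+l) / k) ^ s := by
  have hle : -(π/4) ≤ π/4 := by linarith [pi_pos]
  have hkr : (1:ℝ) ≤ k := by exact_mod_cast hk
  have hM : 0 < 2 * ((k:ℝ)+l) / k := by positivity
  rw [← intervalIntegral.integral_const_mul]
  have hne : ∀ᵐ θ : ℝ, θ ≠ 0 := by simp [ae_iff]
  have h := intervalIntegral.norm_integral_le_of_norm_le (μ := volume) hle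
    (f := fun θ => √((2*k+2*l).choose (2*k) : ℝ) * (β θ * sin θ ^ (2*k) * cos θ ^ (2*l)))
    (g := fun θ => c⁻¹ * (|θ| ^ (-(1:ℝ) - 2*s) * min 1 (2 * ((k:ℝ)+l) / k * θ^2))) ?_ ?_
  · rw [Real.norm_eq_abs] at h
    refine h.trans ?_
    rw [intervalIntegral.integral_const_mul, mul_assoc, mul_comm (∫ θ, gg s θ)]
    exact mul_le_mul_of_nonneg_left (gg_scale_bound s _ hs0 hs1 hM) (by positivity)
  · filter_upwards [hne] with θ h0 hθ
    have hb := beta_bound hs0 hc hβ ⟨hθ.1.le, hθ.2⟩ h0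
    have h3 := aux_binom3 θ k l hk
    rw [Real.norm_eq_abs, abs_mul, abs_of_nonneg (Real.sqrt_nonneg _), mul_assoc (β θ), abs_mul]
    calc _ = |β θ| * (√((2*k+2*l).choose (2*k) : ℝ) * |sin θ ^ (2*k) * cos θ ^ (2*l)|) := by ring
      _ ≤ (c⁻¹ * |θ| ^ (-(1:ℝ) - 2*s)) * min 1 (2 * ((k:ℝ)+l) / k * θ^2) :=
        mul_le_mul hb.2 h3 (by positivity) (by positivity)
      _ = _ := by ring
  · exact ((gg_scale_int s _ hs0 hs1 hM).const_mul _).intervalIntegrable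

end

lemma sqrt_bound (k l : ℕ) (h : 1 ≤ k) (hkl : k ≤ l) :
    √((2*(k:ℝ) + 2*(l:ℝ) + 1) / ((2*(k:ℝ) + 1) * (2*(l:ℝ) + 1))) ≤ (k:ℝ) ^ (-(1/2:ℝ)) := by
  have hkr : (1:ℝ) ≤ k := by exact_mod_cast h
  have hklr : (k:ℝ) ≤ l := by exact_mod_cast hkl
  rw [Real.rpow_neg (by linarith), ← Real.inv_rpow (by linarith), ← Real.sqrt_eq_rpow]
  apply Real.sqrt_le_sqrt
  rw [← one_div, div_le_div_iff₀ (by positivity) (by linarith)]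
  nlinarith

lemma alg1 (s k l : ℝ) (hs0 : 0 < s) (hs1 : s < 1) (hk : 1 ≤ k) (hkl : k ≤ l) :
    k ^ (-(1/2:ℝ)) * (2 * (k+l)/k)^s ≤ 4 * (k ^ (-(1/2:ℝ) - s) * l^(s/2) * (k+l)^(s/2)) := by
  have hk0 : 0 < k := by linarith
  have hl0 : 0 < l := by linarith
  rw [Real.div_rpow (by positivity) hk0.le, Real.rpow_sub hk0]
  have h1 : (2*(k+l))^s ≤ 4 * (l^(s/2) * (k+l)^(s/2)) := by
    have e : (2*(k+l))^s = (2*(k+l))^(s/2) * (2*(k+l))^(s/2) := by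
      rw [← Real.rpow_add (by positivity)]; congr 1; ring
    rw [e]
    have a1 : (2*(k+l))^(s/2) ≤ (4*l)^(s/2) := Real.rpow_le_rpow (by positivity) (by linarith) (by linarith)
    have a2 : (4:ℝ)^(s/2) * 2^(s/2) ≤ 4 := by
      rw [← Real.mul_rpow (by norm_num) (by norm_num)]
      calc ((4:ℝ)*2)^(s/2) ≤ (4*4)^(s/2) := Real.rpow_le_rpow (by norm_num) (by norm_num) (by linarith)
        _ ≤ (4*4)^(1/2:ℝ) := Real.rpow_le_rpow_of_exponent_le (by norm_num) (by linarith)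
        _ = 4 := by rw [← Real.sqrt_eq_rpow, Real.sqrt_mul_self (by norm_num)]
    calc (2*(k+l))^(s/2) * (2*(k+l))^(s/2) ≤ (4*l)^(s/2) * (2*(k+l))^(s/2) := by gcongr
      _ = ((4:ℝ)^(s/2) * 2^(s/2)) * (l^(s/2) * (k+l)^(s/2)) := by
        rw [Real.mul_rpow (by norm_num) hl0.le, Real.mul_rpow (by norm_num) (by linarith)]; ring
      _ ≤ _ := by gcongr
  calc k ^ (-(1/2:ℝ)) * ((2*(k+l))^s / k^s) = (k ^ (-(1/2:ℝ)) / k^s) * (2*(k+l))^s := by ring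
    _ ≤ (k ^ (-(1/2:ℝ)) / k^s) * (4 * (l^(s/2) * (k+l)^(s/2))) := by gcongr
    _ = _ := by ring

lemma alg2 (s k l : ℝ) (hs0 : 0 < s) (hs1 : s < 1) (hl : 1 ≤ l) (hkl : l ≤ k) :
    l ^ (-(1/2:ℝ)) * (2 * (k+l)/k)^s ≤ 4 * (l ^ (-(1/2:ℝ) - s) * k^(s/2) * (k+l)^(s/2)) := by
  have hk0 : 0 < k := by linarith
  have hl0 : 0 < l := by linarith
  have h1 : (2 * (k+l)/k)^s ≤ 4 := by
    have : 2 * (k+l)/k ≤ 4 := by rw [div_le_iff₀ hk0]; linarith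
    calc (2 * (k+l)/k)^s ≤ 4 ^ s := Real.rpow_le_rpow (by positivity) this hs0.le
      _ ≤ 4^(1:ℝ) := Real.rpow_le_rpow_of_exponent_le (by norm_num) hs1.le
      _ = 4 := by simp
  have h2 : l ^ (-(1/2:ℝ)) = l ^ (-(1/2:ℝ) - s) * l^(s/2) * l^(s/2) := by
    rw [← Real.rpow_add hl0, ← Real.rpow_add hl0]; congr 1; ring
  have h3 : l^(s/2) ≤ k^(s/2) := Real.rpow_le_rpow hl0.le hkl (by linarith)
  have h4 : l^(s/2) ≤ (k+l)^(s/2) := Real.rpow_le_rpow hl0.le (by linarith) (by linarith)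
  calc _ ≤ l ^ (-(1/2:ℝ)) * 4 := by gcongr
    _ = 4 * (l ^ (-(1/2:ℝ) - s) * l^(s/2) * l^(s/2)) := by rw [h2]; ring
    _ ≤ _ := by gcongr

lemma W_bound (s : ℝ) (hs0 : 0 < s) : ∃ W : ℝ, ∀ N : ℕ,
    ∑ k ∈ Finset.Icc 2 N, ((k:ℝ) ^ (-(1/2:ℝ) - s)) ^ 2 ≤ W := by
  have hsum : Summable (fun n : ℕ => (n:ℝ) ^ (-(1:ℝ) - 2*s)) :=
    Real.summable_nat_rpow.2 (by linarith)
  refine ⟨∑' n : ℕ, (n:ℝ) ^ (-(1:ℝ) - 2*s), fun N => ?_⟩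
  refine le_trans (le_of_eq ?_) (hsum.sum_le_tsum (Finset.Icc 2 N) (fun i _ => by positivity))
  refine Finset.sum_congr rfl (fun k _ => ?_)
  rw [← Real.rpow_natCast, ← Real.rpow_mul (by positivity)]
  congr 1; push_cast; ring

lemma main_tri (s : ℝ) (hs0 : 0 < s) (W : ℝ) (hW : ∀ N : ℕ,
    ∑ k ∈ Finset.Icc 2 N, ((k:ℝ) ^ (-(1/2:ℝ) - s)) ^ 2 ≤ W) (C2 : ℝ) (hC2 : 0 ≤ C2)
    (cc : ℕ → ℕ → ℝ)
    (hcc : ∀ k l : ℕ, 1 ≤ k → 1 ≤ l → |cc k l| ≤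
      C2 * ((k:ℝ) ^ (-(1/2:ℝ) - s) * (l:ℝ)^(s/2) * ((k:ℝ)+l)^(s/2) +
        (l:ℝ) ^ (-(1/2:ℝ) - s) * (k:ℝ)^(s/2) * ((k:ℝ)+l)^(s/2)))
    (y : ℕ → ℝ) (hy : ∀ n, 0 ≤ y n) (hy1 : y 1 = 0) (N : ℕ) :
    ∑ n ∈ Finset.Icc 2 N, ∑ k ∈ Finset.Icc 1 (n-1), |cc k (n-k)| * y k * y (n-k) * y n ≤
      2 * C2 * √W * √(∑ n ∈ Finset.Icc 2 N, y n ^ 2) *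
        ∑ n ∈ Finset.Icc 2 N, (n:ℝ)^s * y n ^ 2 := by
  set w : ℕ → ℝ := fun k => (k:ℝ) ^ (-(1/2:ℝ) - s) with hw
  set z : ℕ → ℝ := fun n => (n:ℝ)^(s/2) * y n with hz
  have htri := aux_tri w y z (fun n => by positivity) hy
    (fun n => mul_nonneg (by positivity) (hy n))
    (by simp only [hz]; rw [Nat.cast_zero, Real.zero_rpow (by linarith), zero_mul])
    (by simp [hz, hy1]) hy1 W hW N
  have hD : ∑ n ∈ Finset.Icc 2 N, z n ^ 2 = ∑ n ∈ Finset.Icc 2 N, (n:ℝ)^s * y n ^ 2 := by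
    refine Finset.sum_congr rfl (fun n _ => ?_)
    simp only [hz]
    rw [mul_pow, ← Real.rpow_natCast ((n:ℝ)^(s/2)) 2, ← Real.rpow_mul (by positivity)]
    congr 2; push_cast; ring
  rw [hD] at htri
  have hflip : ∀ n : ℕ, ∑ k ∈ Finset.Icc 1 (n-1), w (n-k) * y (n-k) * z k * z n =
      ∑ k ∈ Finset.Icc 1 (n-1), w k * y k * z (n-k) * z n := by
    intro n
    refine Finset.sum_nbij' (fun k => n - k) (fun k => n - k) ?_ ?_ ?_ ?_ ?_
    · intro k hk; simp at *; omega
    · intro k hk; simp at *; omega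
    · intro k hk; simp at *; omega
    · intro k hk; simp at *; omega
    · intro k hk
      have : n - (n - k) = k := by simp at hk; omega
      simp only [this]
  calc _ ≤ ∑ n ∈ Finset.Icc 2 N, ∑ k ∈ Finset.Icc 1 (n-1),
        (C2 * (w k * y k * z (n-k) * z n) + C2 * (w (n-k) * y (n-k) * z k * z n)) := by
        refine Finset.sum_le_sum (fun n hn => Finset.sum_le_sum (fun k hk => ?_))
        have hk' := Finset.mem_Icc.1 hk
        have h := hcc k (n-k) hk'.1 (by omega)
        have e : (k:ℝ) + ((n-k : ℕ):ℝ) = n := by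
          rw [← Nat.cast_add]; congr 1; omega
        rw [e] at h
        have hyy : 0 ≤ y k * y (n-k) * y n := mul_nonneg (mul_nonneg (hy _) (hy _)) (hy _)
        calc |cc k (n-k)| * y k * y (n-k) * y n = |cc k (n-k)| * (y k * y (n-k) * y n) := by ring
          _ ≤ _ * (y k * y (n-k) * y n) := mul_le_mul_of_nonneg_right h hyy
          _ = _ := by simp only [hw, hz]; ring
    _ = 2 * C2 * ∑ n ∈ Finset.Icc 2 N, ∑ k ∈ Finset.Icc 1 (n-1), w k * y k * z (n-k) * z n := by
        simp_rw [Finset.sum_add_distrib, ← Finset.mul_sum, hflip]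
        ring
    _ ≤ 2 * C2 * (√W * √(∑ n ∈ Finset.Icc 2 N, y n ^ 2) *
          ∑ n ∈ Finset.Icc 2 N, (n:ℝ)^s * y n ^ 2) :=
        mul_le_mul_of_nonneg_left htri (by positivity)
    _ = _ := by ring

theorem uniform_a_priori_bound
    (s : ℝ) (hs0 : 0 < s) (hs1 : s < 1) (β : ℝ → ℝ) (hβmeas : Measurable β)
    (c : ℝ) (hc : 0 < c)
    (hβbound : ∀ θ ∈ Set.Icc (-(π/4)) (π/4), θ ≠ 0 →
      c * |θ| ^ (-(1:ℝ) - 2*s) ≤ β θ ∧ β θ ≤ c⁻¹ * |θ| ^ (-(1:ℝ) - 2*s))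
    (lam : ℕ → ℝ)
    (hlam : ∀ n : ℕ, 1 ≤ n →
      lam n = ∫ θ in (-(π/4))..(π/4),
        β θ * (1 - Real.cos θ ^ (2*n) - Real.sin θ ^ (2*n)))
    (cc : ℕ → ℕ → ℝ)
    (hcc : ∀ k l : ℕ, 1 ≤ k → 1 ≤ l →
      cc k l = Real.sqrt ((2*(k:ℝ) + 2*(l:ℝ) + 1) / ((2*(k:ℝ) + 1) * (2*(l:ℝ) + 1))) *
        Real.sqrt (((2*k + 2*l).choose (2*k) : ℝ)) *
        ∫ θ in (-(π/4))..(π/4), β θ * Real.sin θ ^ (2*k) * Real.cos θ ^ (2*l)) :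
    ∃ ε₀ : ℝ, 0 < ε₀ ∧ ∀ ε : ℝ, 0 < ε → ε ≤ ε₀ →
      ∀ b b' : ℕ → ℝ → ℝ,
        (∀ n : ℕ, ∀ t : ℝ, 0 ≤ t → HasDerivWithinAt (b n) (b' n t) (Set.Ici 0) t) →
        (∀ t : ℝ, b 0 t = 0) → (∀ t : ℝ, b 1 t = 0) →
        (∀ n : ℕ, 2 ≤ n → ∀ t : ℝ, 0 ≤ t →
          b' n t + lam n * b n t =
            ∑ k ∈ Finset.Icc 1 (n-1), cc k (n-k) * b k t * b (n-k) t) →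
        Summable (fun n : ℕ => b (n+2) 0 ^ 2) →
        (∑' n : ℕ, b (n+2) 0 ^ 2) ≤ ε^2 →
        ∀ N : ℕ, 2 ≤ N → ∀ t : ℝ, 0 ≤ t →
          ∑ n ∈ Finset.Icc 2 N, Real.exp (lam n * t) * b n t ^ 2 ≤ ε^2 := by
  obtain ⟨c0, hc0, hlow⟩ := lam_lower hs0 hs1 hβmeas hc hβbound
  obtain ⟨W, hW⟩ := W_bound s hs0
  have hlow' : ∀ n : ℕ, 2 ≤ n → c0 * (n:ℝ)^s ≤ lam n := fun n hn => by
    rw [hlam n (by omega)]; exact hlow n hn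
  have hsubadd : ∀ k l : ℕ, 2 ≤ k → 2 ≤ l → lam (k+l) ≤ lam k + lam l := fun k l hk hl => by
    rw [hlam _ (by omega), hlam k (by omega), hlam l (by omega)]
    exact lam_subadd hs0 hs1 hβmeas hc hβbound k l hk hl
  have hK : 0 ≤ ∫ θ, gg s θ := integral_nonneg (fun θ => gg_nonneg s θ)
  set K := ∫ θ, gg s θ with hKdef
  obtain ⟨C2, hC2, hcc2⟩ : ∃ C2 : ℝ, 0 ≤ C2 ∧ ∀ k l : ℕ, 1 ≤ k → 1 ≤ l → |cc k l| ≤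
      C2 * ((k:ℝ) ^ (-(1/2:ℝ) - s) * (l:ℝ)^(s/2) * ((k:ℝ)+l)^(s/2) +
        (l:ℝ) ^ (-(1/2:ℝ) - s) * (k:ℝ)^(s/2) * ((k:ℝ)+l)^(s/2)) := by
    refine ⟨c⁻¹ * K * 4, by positivity, fun k l hk hl => ?_⟩
    have hkr : (1:ℝ) ≤ k := by exact_mod_cast hk
    have hlr : (1:ℝ) ≤ l := by exact_mod_cast hl
    have h1 := cc_bound1 hs0 hs1 hc hβbound k l hk
    rw [hcc k l hk hl, mul_assoc, abs_mul, abs_of_nonneg (Real.sqrt_nonneg _)]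
    have hcK : 0 ≤ c⁻¹ * K := by positivity
    rcases le_total k l with hkl | hkl
    · have hklr : (k:ℝ) ≤ l := by exact_mod_cast hkl
      have h2 := sqrt_bound k l hk hkl
      have h3 := alg1 s k l hs0 hs1 hkr hklr
      calc _ ≤ (k:ℝ) ^ (-(1/2:ℝ)) * (c⁻¹ * K * (2 * ((k:ℝ)+l) / k) ^ s) :=
            mul_le_mul h2 h1 (abs_nonneg _) (by positivity)
        _ = c⁻¹ * K * ((k:ℝ) ^ (-(1/2:ℝ)) * (2 * ((k:ℝ)+l) / k) ^ s) := by ring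
        _ ≤ c⁻¹ * K * _ := mul_le_mul_of_nonneg_left h3 hcK
        _ = c⁻¹ * K * 4 * ((k:ℝ) ^ (-(1/2:ℝ) - s) * (l:ℝ)^(s/2) * ((k:ℝ)+l)^(s/2)) := by ring
        _ ≤ _ := mul_le_mul_of_nonneg_left (le_add_of_nonneg_right (by positivity)) (by positivity)
    · have hklr : (l:ℝ) ≤ k := by exact_mod_cast hkl
      have h2 := sqrt_bound l k hl hkl
      rw [add_comm (2 * (l:ℝ)), mul_comm (2 * (l:ℝ) + 1)] at h2
      have h3 := alg2 s k l hs0 hs1 hlr hklr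
      calc _ ≤ (l:ℝ) ^ (-(1/2:ℝ)) * (c⁻¹ * K * (2 * ((k:ℝ)+l) / k) ^ s) :=
            mul_le_mul h2 h1 (abs_nonneg _) (by positivity)
        _ = c⁻¹ * K * ((l:ℝ) ^ (-(1/2:ℝ)) * (2 * ((k:ℝ)+l) / k) ^ s) := by ring
        _ ≤ c⁻¹ * K * _ := mul_le_mul_of_nonneg_left h3 hcK
        _ = c⁻¹ * K * 4 * ((l:ℝ) ^ (-(1/2:ℝ) - s) * (k:ℝ)^(s/2) * ((k:ℝ)+l)^(s/2)) := by ring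
        _ ≤ _ := mul_le_mul_of_nonneg_left (le_add_of_nonneg_left (by positivity)) (by positivity)
  refine ⟨c0 / (8 * (C2 * √W + 1)), by positivity, ?_⟩
  intro ε hε hεle b b' hder hb0 hb1 hode hsummable hinit N hN t ht
  have hεbd : 4 * (C2 * √W) * ε ≤ c0 / 2 := by
    rw [le_div_iff₀ (by positivity)] at hεle
    nlinarith
  set E : ℝ → ℝ := fun t => ∑ n ∈ Finset.Icc 2 N, Real.exp (lam n * t) * b n t ^ 2 with hE
  set E' : ℝ → ℝ := fun t => ∑ n ∈ Finset.Icc 2 N,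
    (Real.exp (lam n * t) * lam n * b n t ^ 2 + Real.exp (lam n * t) * (2 * b n t * b' n t)) with hE'
  have hEder : ∀ x, 0 ≤ x → HasDerivWithinAt E (E' x) (Set.Ici 0) x := by
    intro x hx
    simp only [hE, hE']
    apply HasDerivWithinAt.fun_sum
    intro n hn
    have h1 : HasDerivWithinAt (fun t => Real.exp (lam n * t)) (Real.exp (lam n * x) * lam n)
        (Set.Ici 0) x := by
      have := ((hasDerivAt_id x).const_mul (lam n)).exp
      simpa using this.hasDerivWithinAt
    have h2 := (hder n x hx).fun_pow 2
    have h3 := h1.fun_mul h2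
    simpa using h3
  have hfin := image_le_of_deriv_right_lt_deriv_boundary (f := E) (f' := E') (a := 0) (b := t)
    (B := fun _ => ε^2) (B' := fun _ => 0)
    (fun x hx => ((hEder x hx.1).continuousWithinAt).mono (fun y hy => hy.1))
    (fun x hx => (hEder x hx.1).mono (Set.Ici_subset_Ici.2 hx.1)) ?_
    (fun x => hasDerivAt_const x _) ?_ (Set.right_mem_Icc.2 ht)
  · exact hfin
  · simp only [hE, mul_zero, Real.exp_zero, one_mul]
    refine le_trans ?_ hinit
    have e : ∑ n ∈ Finset.Icc 2 N, b n 0 ^ 2 = ∑ n ∈ Finset.range (N-1), b (n+2) 0 ^ 2 := by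
      refine Finset.sum_nbij' (fun n => n - 2) (fun n => n + 2) ?_ ?_ ?_ ?_ ?_
      · intro k hk; simp at *; omega
      · intro k hk; simp at *; omega
      · intro k hk; simp at *; omega
      · intro k hk; simp at *
      · intro k hk
        have : k - 2 + 2 = k := by simp at hk; omega
        simp only [this]
    rw [e]
    exact hsummable.sum_le_tsum _ (fun i _ => sq_nonneg _)
  · intro x hx hEx
    have hx0 : 0 ≤ x := hx.1
    set y : ℕ → ℝ := fun n => Real.exp (lam n * x / 2) * |b n x| with hy
    have hy0 : ∀ n, 0 ≤ y n := fun n => by positivity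
    have hy1 : y 1 = 0 := by simp [hy, hb1]
    have hexp2 : ∀ n, Real.exp (lam n * x) = Real.exp (lam n * x / 2) * Real.exp (lam n * x / 2) := by
      intro n; rw [← Real.exp_add]; congr 1; ring
    have hysq : ∀ n, y n ^ 2 = Real.exp (lam n * x) * b n x ^ 2 := by
      intro n; simp only [hy]; rw [mul_pow, sq_abs, hexp2]; ring
    have htri := main_tri s hs0 W hW C2 hC2 cc hcc2 y hy0 hy1 N
    have hEy : ∑ n ∈ Finset.Icc 2 N, y n ^ 2 = ε^2 := by
      rw [← hEx]; exact Finset.sum_congr rfl (fun n _ => hysq n)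
    rw [hEy, Real.sqrt_sq hε.le] at htri
    set D := ∑ n ∈ Finset.Icc 2 N, (n:ℝ)^s * y n ^ 2 with hD
    have hDE : ε^2 ≤ D := by
      rw [← hEy]
      refine Finset.sum_le_sum (fun n hn => ?_)
      have hn' := Finset.mem_Icc.1 hn
      have : 1 ≤ (n:ℝ)^s := Real.one_le_rpow (by exact_mod_cast (by omega : 1 ≤ n)) hs0.le
      exact le_mul_of_one_le_left (sq_nonneg _) this
    have hEle : E' x ≤ ∑ n ∈ Finset.Icc 2 N, (-(c0 * ((n:ℝ)^s * y n ^ 2)) +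
        2 * ∑ k ∈ Finset.Icc 1 (n-1), |cc k (n-k)| * y k * y (n-k) * y n) := by
      refine Finset.sum_le_sum (fun n hn => ?_)
      have hn' := Finset.mem_Icc.1 hn
      have ho := hode n hn'.1 x hx0
      have hb' : b' n x = -(lam n * b n x) +
        ∑ k ∈ Finset.Icc 1 (n-1), cc k (n-k) * b k x * b (n-k) x := by linarith
      have e1 : Real.exp (lam n * x) * lam n * b n x ^ 2 +
          Real.exp (lam n * x) * (2 * b n x * b' n x) = -(lam n * y n ^ 2) +
          2 * ∑ k ∈ Finset.Icc 1 (n-1),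
            Real.exp (lam n * x) * b n x * (cc k (n-k) * b k x * b (n-k) x) := by
        rw [← Finset.mul_sum, hb', hysq]; ring
      rw [e1]
      apply add_le_add
      · have := mul_le_mul_of_nonneg_right (hlow' n hn'.1) (sq_nonneg (y n))
        linarith
      · apply mul_le_mul_of_nonneg_left _ (by norm_num)
        refine Finset.sum_le_sum (fun k hk => ?_)
        have hk' := Finset.mem_Icc.1 hk
        rcases eq_or_ne k 1 with rfl | hk1
        · simp [hb1, hy1]
        rcases eq_or_ne (n-k) 1 with hl1 | hl1
        · simp [hl1, hb1, hy1]
        have hsa := hsubadd k (n-k) (by omega) (by omega)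
        rw [show k + (n-k) = n by omega] at hsa
        have hee : Real.exp (lam n * x / 2) ≤
            Real.exp (lam k * x / 2) * Real.exp (lam (n-k) * x / 2) := by
          rw [← Real.exp_add]
          apply Real.exp_le_exp.2
          nlinarith
        refine (le_abs_self _).trans ?_
        simp only [abs_mul, abs_of_pos (Real.exp_pos _), hy]
        rw [hexp2]
        calc _ = (|cc k (n-k)| * |b k x| * |b (n-k) x| * |b n x| * Real.exp (lam n * x / 2)) *
              Real.exp (lam n * x / 2) := by ring
          _ ≤ (|cc k (n-k)| * |b k x| * |b (n-k) x| * |b n x| * Real.exp (lam n * x / 2)) *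
              (Real.exp (lam k * x / 2) * Real.exp (lam (n-k) * x / 2)) :=
              mul_le_mul_of_nonneg_left hee (by positivity)
          _ = _ := by ring
    rw [Finset.sum_add_distrib, Finset.sum_neg_distrib, ← Finset.mul_sum, ← Finset.mul_sum] at hEle
    have hDpos : 0 < D := lt_of_lt_of_le (by positivity) hDE
    have h5 : 4 * (C2 * √W) * ε * D ≤ c0 / 2 * D := mul_le_mul_of_nonneg_right hεbd hDpos.le
    have h6 : 0 < c0 * D := by positivity
    rw [← hD] at hEle
    change E' x < 0
    nlinarith
end

section
/- Let 0 < s < 1 and let β : ℝ → ℝ be a measurable function such that for some constant c > 0 one has c·|θ|^(−1−2s) ≤ β(θ) ≤ c⁻¹·|θ|^(−1−2s) for all θ ∈ [−π/4, π/4] \ {0}. For each integer n ≥ 1 set λ_{2n} = ∫_{−π/4}^{π/4} β(θ)·(1 − (cos θ)^{2n} − (sin θ)^{2n}) dθ, and for integers k, l ≥ 1 set c_{k,l} = √((2k+2l+1)/((2k+1)(2l+1)))·√(C(2k+2l, 2k))·∫_{−π/4}^{π/4} β(θ)·(sin θ)^{2k}·(cos θ)^{2l} dθ. Then for every δ with 0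 < δ < 1 there exists ε > 0 such that for every family of differentiable functions b_n : [0, ∞) → ℝ (n ≥ 0) with b_0 ≡ 0, b_1 ≡ 0, satisfying for all n ≥ 2 and t ≥ 0 the differential equations b_n'(t) + λ_{2n}·b_n(t) = Σ_{k+l=n, k≥1, l≥1} c_{k,l}·b_k(t)·b_l(t), the following holds: if Σ_{n≥2} b_n(0)² ≤ ε², then for every t ≥ 0, Σ_{n≥2} e^{λ_{2n}t}·b_n(t)² ≤ e^{−λ_4(1−δ)t}·Σ_{n≥2} b_n(0)². -/
open Real MeasureTheory

theorem aux_bin (M r : ℕ) (S : ℝ) (h0 : 0 ≤ S) (h1 : S ≤ 1) (hr : 2 * r ≤ M + 1) :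
    ∑ i ∈ Finset.range r, (M.choose (2*i) : ℝ) * S^(2*i) * (1-S)^(M-2*i) ≤ 1 := by
  have h2 : 0 ≤ 1 - S := by linarith
  have key : ∑ j ∈ Finset.range (M+1), S^j * (1-S)^(M-j) * (M.choose j : ℝ) = 1 := by
    rw [← add_pow]; simp
  refine le_trans ?_ key.le
  have : ∑ i ∈ Finset.range r, (M.choose (2*i) : ℝ) * S^(2*i) * (1-S)^(M-2*i)
      = ∑ j ∈ (Finset.range r).image (fun i => 2*i), S^j * (1-S)^(M-j) * (M.choose j : ℝ) := by
    rw [Finset.sum_image (by intro a _ b _ h; simpa using h)]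
    exact Finset.sum_congr rfl (fun i _ => by ring)
  rw [this]
  apply Finset.sum_le_sum_of_subset_of_nonneg
  · intro j hj
    simp only [Finset.mem_image, Finset.mem_range] at hj ⊢
    obtain ⟨i, hi, rfl⟩ := hj
    omega
  · intros; positivity

theorem aux_bin2 (n : ℕ) (hn : 2 ≤ n) (S : ℝ) (h0 : 0 ≤ S) (h1 : S ≤ 1) :
    ∑ k ∈ Finset.Icc 1 (n-1), ((2*k+2*(n-k)).choose (2*k) : ℝ) * S^(2*k) * (1-S)^(2*(n-k))
      ≤ 2 * (min 1 (n*S))^2 := by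
  have h2 : 0 ≤ 1 - S := by linarith
  have e : ∑ k ∈ Finset.Icc 1 (n-1), ((2*k+2*(n-k)).choose (2*k) : ℝ) * S^(2*k) * (1-S)^(2*(n-k))
      = ∑ i ∈ Finset.range (n-1), ((2*n).choose (2*i+2) : ℝ) * S^(2*i+2) * (1-S)^(2*n-2-2*i) := by
    have : Finset.Icc 1 (n-1) = Finset.Ico (0+1) (n-1+1) := by
      ext; simp only [Finset.mem_Icc, Finset.mem_Ico]; omega
    rw [this, ← Finset.sum_Ico_add', ← Finset.range_eq_Ico]
    apply Finset.sum_congr rfl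
    intro i hi
    have hi' := Finset.mem_range.1 hi
    rw [show 2*(i+1)+2*(n-(i+1)) = 2*n by omega, show 2*(n-(i+1)) = 2*n-2-2*i by omega,
      show 2*(i+1) = 2*i+2 by omega]
  have A : ∑ i ∈ Finset.range (n-1), ((2*n).choose (2*i+2) : ℝ) * S^(2*i+2) * (1-S)^(2*n-2-2*i) ≤ 1 := by
    have := aux_bin (2*n) n S h0 h1 (by omega)
    obtain ⟨m, rfl⟩ : ∃ m, n = m+1 := ⟨n-1, by omega⟩
    rw [Finset.sum_range_succ'] at this
    refine le_trans ?_ (le_trans (le_add_of_nonneg_right ?_) this)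
    · apply le_of_eq
      apply Finset.sum_congr rfl
      intro i hi
      congr 2
      omega
    · positivity
  have B : ∑ i ∈ Finset.range (n-1), ((2*n).choose (2*i+2) : ℝ) * S^(2*i+2) * (1-S)^(2*n-2-2*i) ≤ 2*(n*S)^2 := by
    have := aux_bin (2*n-2) (n-1) S h0 h1 (by omega)
    have hc : ((2*n).choose 2 : ℝ) ≤ 2*n^2 := by
      rw [Nat.cast_choose_two]; push_cast; nlinarith [(Nat.cast_nonneg n : (0:ℝ) ≤ n)]
    calc _ ≤ ∑ i ∈ Finset.range (n-1), (2*(n*S)^2) * (((2*n-2).choose (2*i) : ℝ) * S^(2*i) * (1-S)^(2*n-2-2*i)) := by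
          apply Finset.sum_le_sum
          intro i hi
          have hi' := Finset.mem_range.1 hi
          have h3 : ((2*n).choose (2*i+2) : ℝ) ≤ 2*n^2 * ((2*n-2).choose (2*i) : ℝ) := by
            have h4 := Nat.choose_mul (n := 2*n) (k := 2*i+2) (s := 2) (by omega)
            have h5 : 1 ≤ (2*i+2).choose 2 := Nat.choose_pos (by omega)
            have h6 : (2*n).choose (2*i+2) ≤ (2*n).choose 2 * (2*n-2).choose (2*i) := by
              have : 2*i+2-2 = 2*i := by omega
              rw [this] at h4
              rw [← h4]; nlinarith
            calc ((2*n).choose (2*i+2) : ℝ) ≤ ((2*n).choose 2 : ℝ) * ((2*n-2).choose (2*i) : ℝ) := by exact_mod_cast h6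
              _ ≤ _ := by gcongr
          calc _ ≤ (2*n^2 * ((2*n-2).choose (2*i) : ℝ)) * S^(2*i+2) * (1-S)^(2*n-2-2*i) := by gcongr
            _ = _ := by ring
      _ = (2*(n*S)^2) * ∑ i ∈ Finset.range (n-1), (((2*n-2).choose (2*i) : ℝ) * S^(2*i) * (1-S)^(2*n-2-2*i)) := by rw [Finset.mul_sum]
      _ ≤ (2*(n*S)^2) * 1 := by gcongr
      _ = _ := by ring
  rw [e]
  rcases min_choice 1 ((n:ℝ)*S) with h | h <;> rw [h] <;> linarith

theorem aux_low (n : ℕ) (hn : 2 ≤ n) (S : ℝ) (h0 : 0 ≤ S) (h1 : S ≤ 1/2) :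
    min 1 (n*S) ≤ 4 * (1 - (1-S)^n - S^n) := by
  obtain ⟨m, rfl⟩ : ∃ m, n = m+1 := ⟨n-1, by omega⟩
  have hm : (1:ℝ) ≤ m := by exact_mod_cast (by omega : 1 ≤ m)
  have a1 : S^m ≤ (1-S)^m := by gcongr; linarith
  have a2 : (1-S)^(m+1) + S^(m+1) ≤ (1-S)^m := by
    rw [pow_succ, pow_succ]; nlinarith
  have a3 : (1-S)^m * (1+m*S) ≤ 1 := by
    calc _ ≤ (1-S)^m * (1+S)^m := by
          have := one_add_mul_le_pow (by linarith : -2 ≤ S) m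
          have : 0 ≤ 1 - S := by linarith
          gcongr
      _ = (1-S^2)^m := by rw [← mul_pow]; ring
      _ ≤ 1 := pow_le_one₀ (by nlinarith) (by nlinarith)
  have a4 : 0 ≤ (1-S)^m := pow_nonneg (by linarith) _
  set q := (1-S)^m
  push_cast
  have hmS : 0 ≤ (m-1) * S := mul_nonneg (by linarith) h0
  have hmS' : 0 ≤ m * S := mul_nonneg (by linarith) h0
  suffices min 1 ((m+1:ℝ)*S) ≤ 4*(1-q) by linarith
  by_cases hh : m * S ≤ 1
  · refine (min_le_right _ _).trans ?_
    nlinarith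
  · refine (min_le_left _ _).trans ?_
    push Not at hh
    nlinarith

theorem aux_sub (k l : ℕ) (hk : 2 ≤ k) (hl : 2 ≤ l) (S : ℝ) (h0 : 0 ≤ S) (h1 : S ≤ 1) :
    1 - (1-S)^(k+l) - S^(k+l) ≤ (1 - (1-S)^k - S^k) + (1 - (1-S)^l - S^l) := by
  have h2 : 0 ≤ 1 - S := by linarith
  have a1 := pow_le_pow_of_le_one h0 h1 hk
  have a2 := pow_le_pow_of_le_one h0 h1 hl
  have a3 := pow_le_pow_of_le_one h2 (by linarith) hk
  have a4 := pow_le_pow_of_le_one h2 (by linarith) hl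
  have b1 : (1 - S^2)*(1-S^2) ≤ (1-S^k)*(1-S^l) := by
    apply mul_le_mul <;> nlinarith
  have b2 : (1 - (1-S)^2)*(1-(1-S)^2) ≤ (1-(1-S)^k)*(1-(1-S)^l) := by
    apply mul_le_mul <;> nlinarith
  have b3 : (1 - S^2)*(1-S^2) + (1 - (1-S)^2)*(1-(1-S)^2) = 1 + 2*(S*(1-S))^2 := by ring
  rw [pow_add, pow_add]
  nlinarith [sq_nonneg (S*(1-S))]

theorem aux_tri_s16 (lam mu : ℕ → ℝ) (cc : ℕ → ℕ → ℝ) (hmu0 : ∀ n, 0 ≤ mu n)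
    (hsub : ∀ k l, mu (k+l) ≤ mu k + mu l) (hlm : ∀ n, 2 ≤ n → mu n ≤ 4 * lam n)
    (hc : ∀ n, 2 ≤ n → ∀ y : ℕ → ℝ, ∑ k ∈ Finset.Icc 1 (n-1), cc k (n-k) * y k ≤
      √2 * mu n * √(∑ k ∈ Finset.Icc 1 (n-1), y k ^ 2))
    (x : ℕ → ℝ) (hx : ∀ n, 0 ≤ x n) (hx0 : x 0 = 0) (hx1 : x 1 = 0) (M : ℕ) :
    ∑ n ∈ Finset.range M, x n * ∑ k ∈ Finset.Icc 1 (n-1), cc k (n-k) * (x k * x (n-k)) ≤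
      8 * √(∑ n ∈ Finset.range M, x n ^ 2) * ∑ n ∈ Finset.range M, lam n * x n ^ 2 := by
  set Q : ℕ → ℝ := fun n => ∑ k ∈ Finset.Icc 1 (n-1), (x k * x (n-k))^2 with hQ
  have hQ0 : ∀ n, 0 ≤ Q n := fun n => Finset.sum_nonneg (fun _ _ => sq_nonneg _)
  set X := ∑ n ∈ Finset.range M, x n ^ 2 with hX
  set L := ∑ n ∈ Finset.range M, mu n * x n ^ 2 with hL
  have hX0 : 0 ≤ X := Finset.sum_nonneg (fun _ _ => sq_nonneg _)
  have hL0 : 0 ≤ L := Finset.sum_nonneg (fun n _ => mul_nonneg (hmu0 n) (sq_nonneg _))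
  have s1 : ∑ n ∈ Finset.range M, x n * ∑ k ∈ Finset.Icc 1 (n-1), cc k (n-k) * (x k * x (n-k))
      ≤ √2 * ∑ n ∈ Finset.range M, (√(mu n) * x n) * √(mu n * Q n) := by
    rw [Finset.mul_sum]
    apply Finset.sum_le_sum
    intro n _
    by_cases hn : 2 ≤ n
    · calc _ ≤ x n * (√2 * mu n * √(Q n)) := mul_le_mul_of_nonneg_left (hc n hn _) (hx n)
        _ = _ := by
          rw [Real.sqrt_mul (hmu0 n)]
          nth_rewrite 1 [← Real.mul_self_sqrt (hmu0 n)]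
          ring
    · have : x n = 0 := by interval_cases n <;> assumption
      simp [this]
  have s2 : ∑ n ∈ Finset.range M, (√(mu n) * x n) * √(mu n * Q n) ≤
      √L * √(∑ n ∈ Finset.range M, mu n * Q n) := by
    refine (Real.sum_mul_le_sqrt_mul_sqrt _ _ _).trans (le_of_eq ?_)
    congr 2
    · apply Finset.sum_congr rfl
      intro n _
      rw [mul_pow, Real.sq_sqrt (hmu0 n)]
    · apply Finset.sum_congr rfl
      intro n _
      rw [Real.sq_sqrt (mul_nonneg (hmu0 n) (hQ0 n))]
  have s3 : ∑ n ∈ Finset.range M, mu n * Q n ≤ 2 * X * L := by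
    calc _ ≤ ∑ n ∈ Finset.range M, ∑ k ∈ Finset.range (n+1), (mu k + mu (n-k)) * (x k * x (n-k))^2 := by
          apply Finset.sum_le_sum
          intro n _
          simp only [hQ]
          rw [Finset.mul_sum]
          refine le_trans (Finset.sum_le_sum (g := fun k => (mu k + mu (n-k)) * (x k * x (n-k))^2) ?_) ?_
          · intro k hk
            rw [Finset.mem_Icc] at hk
            have := hsub k (n-k)
            rw [show k + (n-k) = n by omega] at this
            gcongr
          · apply Finset.sum_le_sum_of_subset_of_nonneg
            · intro k hk
              rw [Finset.mem_Icc] at hk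
              rw [Finset.mem_range]; omega
            · intro k _ _
              exact mul_nonneg (add_nonneg (hmu0 _) (hmu0 _)) (sq_nonneg _)
      _ = ∑ m ∈ Finset.range M, ∑ k ∈ Finset.range (M-m), (mu m + mu k) * (x m * x k)^2 :=
          Finset.sum_range_diag_flip M (fun k l => (mu k + mu l) * (x k * x l)^2)
      _ ≤ ∑ m ∈ Finset.range M, ∑ k ∈ Finset.range M, (mu m + mu k) * (x m * x k)^2 := by
          apply Finset.sum_le_sum
          intro m _
          apply Finset.sum_le_sum_of_subset_of_nonneg
          · exact Finset.range_subset_range.2 (by omega)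
          · intro k _ _
            exact mul_nonneg (add_nonneg (hmu0 _) (hmu0 _)) (sq_nonneg _)
      _ = L * X + X * L := by
          rw [hL, hX, Finset.sum_mul_sum, Finset.sum_mul_sum, ← Finset.sum_add_distrib]
          apply Finset.sum_congr rfl
          intro m _
          rw [← Finset.sum_add_distrib]
          apply Finset.sum_congr rfl
          intro k _
          ring
      _ = _ := by ring
  have s4 : L ≤ 4 * ∑ n ∈ Finset.range M, lam n * x n ^ 2 := by
    rw [hL, Finset.mul_sum]
    apply Finset.sum_le_sum
    intro n _
    by_cases hn : 2 ≤ n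
    · rw [← mul_assoc]
      exact mul_le_mul_of_nonneg_right (hlm n hn) (sq_nonneg _)
    · have : x n = 0 := by interval_cases n <;> assumption
      simp [this]
  calc _ ≤ √2 * (√L * √(2*X*L)) := by
        refine s1.trans (mul_le_mul_of_nonneg_left (s2.trans ?_) (Real.sqrt_nonneg _))
        gcongr
    _ = 2 * √X * L := by
        rw [Real.sqrt_mul (by positivity), Real.sqrt_mul (by positivity)]
        have h2 := Real.mul_self_sqrt (show (0:ℝ) ≤ 2 by norm_num)
        have h3 := Real.mul_self_sqrt hL0
        calc _ = (√2*√2) * √X * (√L*√L) := by ring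
          _ = _ := by rw [h2, h3]
    _ ≤ 2 * √X * (4 * ∑ n ∈ Finset.range M, lam n * x n ^ 2) := by gcongr
    _ = _ := by ring

theorem aux_int (s : ℝ) (hs1 : s < 1) (β : ℝ → ℝ) (hβmeas : Measurable β)
    (c : ℝ) (hc : 0 < c)
    (hβbound : ∀ θ ∈ Set.Icc (-(π/4)) (π/4), θ ≠ 0 →
      c * |θ| ^ (-(1:ℝ) - 2*s) ≤ β θ ∧ β θ ≤ c⁻¹ * |θ| ^ (-(1:ℝ) - 2*s))
    (h : ℝ → ℝ) (hh : Continuous h) (K : ℝ) (hK : ∀ θ, |h θ| ≤ K * sin θ ^ 2) :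
    IntervalIntegrable (fun θ => β θ * h θ) volume (-(π/4)) (π/4) := by
  have hpi := Real.pi_pos
  have base : IntervalIntegrable (fun θ : ℝ => |θ| ^ (1 - 2*s)) volume (-(π/4)) (π/4) := by
    apply intervalIntegrable_of_even
    · intro x; simp
    · intro x hx
      refine (intervalIntegral.intervalIntegrable_rpow' (r := 1 - 2*s) (by linarith)).congr ?_
      intro y hy
      rw [Set.uIoc_of_le hx.le] at hy
      simp [abs_of_pos hy.1]
    · exact enorm_ne_top
    · exact enorm_ne_top
  refine (base.const_mul (c⁻¹ * |K|)).mono_fun' ?_ ?_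
  · exact (hβmeas.mul hh.measurable).aestronglyMeasurable
  · refine (ae_restrict_mem measurableSet_uIoc).mono ?_
    intro θ hθ
    rw [Set.uIoc_of_le (by linarith)] at hθ
    by_cases h0 : θ = 0
    · subst h0
      have := hK 0
      simp at this
      simp [this]
      positivity
    · obtain ⟨b1, b2⟩ := hβbound θ ⟨hθ.1.le, hθ.2⟩ h0
      have hp : 0 < |θ| := abs_pos.2 h0
      have b0 : 0 ≤ β θ := le_trans (by positivity) b1
      have e : |θ| ^ (1 - 2*s) = |θ| ^ (-(1:ℝ) - 2*s) * |θ|^2 := by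
        rw [← Real.rpow_natCast, ← Real.rpow_add hp]; congr 1; push_cast; ring
      have hsin : sin θ ^ 2 ≤ |θ|^2 := by
        rw [← sq_abs (sin θ)]; exact pow_le_pow_left₀ (abs_nonneg _) abs_sin_le_abs 2
      beta_reduce
      rw [norm_mul, Real.norm_eq_abs, Real.norm_eq_abs, abs_of_nonneg b0]
      rw [e]
      calc β θ * |h θ| ≤ (c⁻¹ * |θ| ^ (-(1:ℝ) - 2*s)) * (|K| * |θ|^2) := by
            gcongr
            refine (hK θ).trans ?_
            calc K * sin θ ^2 ≤ |K| * sin θ ^ 2 := by gcongr; exact le_abs_self K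
              _ ≤ _ := by gcongr
        _ = _ := by ring

theorem aux_sin (θ : ℝ) (hθ : θ ∈ Set.Icc (-(π/4)) (π/4)) : sin θ ^ 2 ≤ 1/2 := by
  have h : 0 ≤ cos (2*θ) := cos_nonneg_of_neg_pi_div_two_le_of_le (by linarith [hθ.1]) (by linarith [hθ.2])
  rw [cos_two_mul'] at h
  linarith [sin_sq_add_cos_sq θ]

theorem aux_coef (β : ℝ → ℝ)
    (hβ : ∀ θ ∈ Set.Icc (-(π/4)) (π/4), θ ≠ 0 → 0 < β θ)
    (hint : ∀ (h : ℝ → ℝ), Continuous h → ∀ K : ℝ, (∀ θ, |h θ| ≤ K * sin θ ^ 2) → 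
      IntervalIntegrable (fun θ => β θ * h θ) volume (-(π/4)) (π/4))
    (hbin : ∀ (n : ℕ), 2 ≤ n → ∀ (S : ℝ), 0 ≤ S → S ≤ 1 → 
    ∑ k ∈ Finset.Icc 1 (n-1), ((2*k+2*(n-k)).choose (2*k) : ℝ) * S^(2*k) * (1-S)^(2*(n-k))
      ≤ 2 * (min 1 (n*S))^2)
    (cc : ℕ → ℕ → ℝ)
    (hcc : ∀ k l : ℕ, 1 ≤ k → 1 ≤ l →
      cc k l = Real.sqrt ((2*(k:ℝ) + 2*(l:ℝ) + 1) / ((2*(k:ℝ) + 1) * (2*(l:ℝ) + 1))) *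
        Real.sqrt (((2*k + 2*l).choose (2*k) : ℝ)) *
        ∫ θ in (-(π/4))..(π/4), β θ * Real.sin θ ^ (2*k) * Real.cos θ ^ (2*l)) :
    (∀ k l, 1 ≤ k → 1 ≤ l → 0 ≤ cc k l) ∧
    ∀ n, 2 ≤ n → ∀ y : ℕ → ℝ, ∑ k ∈ Finset.Icc 1 (n-1), cc k (n-k) * y k ≤
      √2 * (∫ θ in (-(π/4))..(π/4), β θ * min 1 (n * sin θ ^ 2)) * √(∑ k ∈ Finset.Icc 1 (n-1), y k ^ 2) := by
  have hpi := Real.pi_pos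
  have hle : -(π/4) ≤ π/4 := by linarith
  have hI0 : ∀ k l : ℕ, 1 ≤ k → 0 ≤ ∫ θ in (-(π/4))..(π/4), β θ * Real.sin θ ^ (2*k) * Real.cos θ ^ (2*l) := by
    intro k l hk
    apply intervalIntegral.integral_nonneg hle
    intro θ hθ
    by_cases h0 : θ = 0
    · subst h0
      rw [sin_zero, zero_pow (by omega)]; simp
    · have := hβ θ hθ h0
      rw [pow_mul, pow_mul]; positivity
  have hnn : ∀ k l, 1 ≤ k → 1 ≤ l → 0 ≤ cc k l := by
    intro k l hk hl
    rw [hcc k l hk hl]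
    have := hI0 k l hk
    positivity
  refine ⟨hnn, ?_⟩
  intro n hn y
  set Y := √(∑ k ∈ Finset.Icc 1 (n-1), y k ^ 2) with hY
  set g : ℕ → ℝ → ℝ := fun k θ => √((2*k + 2*(n-k)).choose (2*k) : ℝ) * (sin θ ^ (2*k) * cos θ ^ (2*(n-k))) with hg
  have hgi : ∀ k, 1 ≤ k → IntervalIntegrable (fun θ => β θ * (g k θ * |y k|)) volume (-(π/4)) (π/4) := by
    intro k hk
    refine hint _ (by simp only [hg]; fun_prop) (√((2*k + 2*(n-k)).choose (2*k) : ℝ) * |y k|) ?_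
    intro θ
    have a1 : sin θ ^ (2*k) ≤ sin θ ^ 2 := by
      rw [pow_mul]
      exact pow_le_of_le_one (sq_nonneg _) (sin_sq_le_one θ) (by omega)
    have a2 : cos θ ^ (2*(n-k)) ≤ 1 := by
      rw [pow_mul]
      exact pow_le_one₀ (sq_nonneg _) (cos_sq_le_one θ)
    have a3 : 0 ≤ sin θ ^ (2*k) := by rw [pow_mul]; positivity
    have a4 : 0 ≤ cos θ ^ (2*(n-k)) := by rw [pow_mul]; positivity
    simp only [hg]
    rw [abs_of_nonneg (by positivity)]
    have : sin θ ^ (2*k) * cos θ ^ (2*(n-k)) ≤ sin θ ^ 2 * 1 := mul_le_mul a1 a2 a4 (sq_nonneg _)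
    calc _ ≤ √((2*k + 2*(n-k)).choose (2*k) : ℝ) * (sin θ ^ 2 * 1) * |y k| := by gcongr
      _ = _ := by ring
  have hmi : IntervalIntegrable (fun θ => β θ * min 1 (n * sin θ ^ 2)) volume (-(π/4)) (π/4) := by
    refine hint _ (by fun_prop) n ?_
    intro θ
    rw [abs_of_nonneg (by positivity)]
    exact min_le_right _ _
  have st1 : ∀ k ∈ Finset.Icc 1 (n-1), cc k (n-k) * y k ≤ ∫ θ in (-(π/4))..(π/4), β θ * (g k θ * |y k|) := by
    intro k hk
    rw [Finset.mem_Icc] at hk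
    have hl : 1 ≤ n - k := by omega
    have e : ∫ θ in (-(π/4))..(π/4), β θ * (g k θ * |y k|) =
        (√((2*k + 2*(n-k)).choose (2*k) : ℝ) * ∫ θ in (-(π/4))..(π/4), β θ * Real.sin θ ^ (2*k) * Real.cos θ ^ (2*(n-k))) * |y k| := by
      rw [mul_right_comm, ← intervalIntegral.integral_const_mul]
      congr 1; ext θ; simp only [hg]; ring
    rw [e]
    have := hI0 k (n-k) hk.1
    calc _ ≤ cc k (n-k) * |y k| := by
          have := hnn k (n-k) hk.1 hl
          gcongr; exact le_abs_self _
      _ ≤ _ := by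
          rw [hcc k (n-k) hk.1 hl]
          gcongr
          refine mul_le_of_le_one_left (by positivity) ?_
          rw [Real.sqrt_le_one]
          rw [div_le_one (by positivity)]
          have : (0:ℝ) ≤ (k:ℝ) * ((n-k:ℕ):ℝ) := by positivity
          nlinarith
  calc _ ≤ ∑ k ∈ Finset.Icc 1 (n-1), ∫ θ in (-(π/4))..(π/4), β θ * (g k θ * |y k|) := Finset.sum_le_sum st1
    _ = ∫ θ in (-(π/4))..(π/4), ∑ k ∈ Finset.Icc 1 (n-1), β θ * (g k θ * |y k|) := by
        rw [intervalIntegral.integral_finsetSum]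
        intro k hk
        exact hgi k (Finset.mem_Icc.1 hk).1
    _ ≤ ∫ θ in (-(π/4))..(π/4), (√2 * Y) * (β θ * min 1 (n * sin θ ^ 2)) := by
        apply intervalIntegral.integral_mono_on hle
        · have := IntervalIntegrable.sum (Finset.Icc 1 (n-1)) (f := fun k θ => β θ * (g k θ * |y k|)) (fun k hk => hgi k (Finset.mem_Icc.1 hk).1)
          have e : (fun θ => ∑ k ∈ Finset.Icc 1 (n-1), β θ * (g k θ * |y k|)) = ∑ k ∈ Finset.Icc 1 (n-1), fun θ => β θ * (g k θ * |y k|) := by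
            ext θ; simp
          rw [e]; exact this
        · exact hmi.const_mul _
        · intro θ hθ
          by_cases h0 : θ = 0
          · subst h0
            apply le_of_eq
            simp only [sin_zero]
            rw [Finset.sum_eq_zero]
            · simp
            · intro k hk
              have := (Finset.mem_Icc.1 hk).1
              simp only [hg, sin_zero]
              rw [zero_pow (by omega)]; simp
          · have hb := hβ θ hθ h0
            rw [← Finset.mul_sum]
            have cs := Real.sum_mul_le_sqrt_mul_sqrt (Finset.Icc 1 (n-1)) (fun k => g k θ) (fun k => |y k|)
            have hb2 := hbin n hn (sin θ ^ 2) (sq_nonneg _) (sin_sq_le_one θ)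
            have e2 : ∑ k ∈ Finset.Icc 1 (n-1), g k θ ^ 2 ≤ 2 * (min 1 (n * sin θ ^ 2))^2 := by
              refine le_trans (le_of_eq ?_) hb2
              apply Finset.sum_congr rfl
              intro k _
              simp only [hg]
              rw [mul_pow, Real.sq_sqrt (by positivity), ← cos_sq']
              rw [← pow_mul, ← pow_mul]; ring
            have e3 : √(∑ k ∈ Finset.Icc 1 (n-1), g k θ ^ 2) ≤ √2 * min 1 (n * sin θ ^ 2) := by
              refine (Real.sqrt_le_sqrt e2).trans (le_of_eq ?_)
              rw [Real.sqrt_mul (by norm_num), Real.sqrt_sq (by positivity)]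
            have e4 : √(∑ k ∈ Finset.Icc 1 (n-1), |y k| ^ 2) = Y := by simp [hY]
            rw [e4] at cs
            calc _ ≤ β θ * ((√2 * min 1 (n * sin θ ^ 2)) * Y) := by
                  gcongr
                  exact cs.trans (by gcongr)
              _ = _ := by ring
    _ = _ := by rw [intervalIntegral.integral_const_mul]; ring

theorem aux_ode (lam : ℕ → ℝ) (cc : ℕ → ℕ → ℝ) (hpos : 0 < lam 2)
    (hmono : ∀ n, 2 ≤ n → lam 2 ≤ lam n)
    (hsub : ∀ k l, 2 ≤ k → 2 ≤ l → lam (k+l) ≤ lam k + lam l)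
    (hcc0 : ∀ k l, 1 ≤ k → 1 ≤ l → 0 ≤ cc k l)
    (htri : ∀ x : ℕ → ℝ, (∀ n, 0 ≤ x n) → x 0 = 0 → x 1 = 0 → ∀ M : ℕ,
      ∑ n ∈ Finset.range M, x n * ∑ k ∈ Finset.Icc 1 (n-1), cc k (n-k) * (x k * x (n-k)) ≤
      8 * √(∑ n ∈ Finset.range M, x n ^ 2) * ∑ n ∈ Finset.range M, lam n * x n ^ 2)
    (δ : ℝ) (hδ0 : 0 < δ) (hδ1 : δ < 1) (b b' : ℕ → ℝ → ℝ)
    (hd : ∀ n : ℕ, ∀ t : ℝ, 0 ≤ t → HasDerivWithinAt (b n) (b' n t) (Set.Ici 0) t)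
    (hb0 : ∀ t : ℝ, b 0 t = 0) (hb1 : ∀ t : ℝ, b 1 t = 0)
    (heq : ∀ n : ℕ, 2 ≤ n → ∀ t : ℝ, 0 ≤ t →
          b' n t + lam n * b n t =
            ∑ k ∈ Finset.Icc 1 (n-1), cc k (n-k) * b k t * b (n-k) t)
    (M : ℕ) (hM : ∑ n ∈ Finset.range M, b n 0 ^ 2 ≤ (δ/16)^2) (T : ℝ) (hT : 0 ≤ T) :
    ∑ n ∈ Finset.range M, Real.exp (lam n * T) * b n T ^ 2 ≤
      Real.exp (-(lam 2) * (1-δ) * T) * ∑ n ∈ Finset.range M, b n 0 ^ 2 := by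
  set F : ℝ → ℝ := fun t => ∑ n ∈ Finset.range M, Real.exp (lam n * t) * b n t ^ 2 with hF
  set F' : ℝ → ℝ := fun t => ∑ n ∈ Finset.range M,
    Real.exp (lam n * t) * (lam n * b n t ^ 2 + 2 * b n t * b' n t) with hF'
  have hF0 : F 0 = ∑ n ∈ Finset.range M, b n 0 ^ 2 := by simp [hF]
  have hFd : ∀ t, 0 ≤ t → HasDerivWithinAt F (F' t) (Set.Ici 0) t := by
    intro t ht
    apply HasDerivWithinAt.fun_sum
    intro n _
    have e1 : HasDerivAt (fun t => Real.exp (lam n * t)) (Real.exp (lam n * t) * lam n) t := by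
      have := ((hasDerivAt_id t).const_mul (lam n)).exp
      simpa using this
    have := e1.hasDerivWithinAt.mul ((hd n t ht).pow 2)
    refine this.congr_deriv ?_
    push_cast
    simp only [Pi.pow_apply]
    ring
  have hFnn : ∀ t, 0 ≤ F t := fun t => Finset.sum_nonneg (fun n _ => by positivity)
  have main : ∀ t, 0 ≤ t → F t ≤ (δ/16)^2 → F' t ≤ -((1-δ) * lam 2 * F t) := by
    intro t ht hFt
    set x : ℕ → ℝ := fun n => Real.exp (lam n * t / 2) * |b n t| with hx
    have hxn : ∀ n, 0 ≤ x n := fun n => by positivity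
    have hx0 : x 0 = 0 := by simp [hx, hb0]
    have hx1 : x 1 = 0 := by simp [hx, hb1]
    have hx2 : ∀ n, x n ^ 2 = Real.exp (lam n * t) * b n t ^ 2 := by
      intro n
      simp only [hx]
      rw [mul_pow, sq_abs, ← Real.exp_nat_mul]
      congr 2
      push_cast; ring
    have hFx : F t = ∑ n ∈ Finset.range M, x n ^ 2 := by
      simp only [hx2, hF]
    have h8 := htri x hxn hx0 hx1 M
    rw [← hFx] at h8
    set L := ∑ n ∈ Finset.range M, lam n * x n ^ 2 with hL
    have hLF : lam 2 * F t ≤ L := by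
      rw [hFx, Finset.mul_sum]
      apply Finset.sum_le_sum
      intro n _
      by_cases hn : 2 ≤ n
      · exact mul_le_mul_of_nonneg_right (hmono n hn) (sq_nonneg _)
      · have : x n = 0 := by interval_cases n <;> assumption
        simp [this]
    have hterm : F' t ≤ -L + 2 * ∑ n ∈ Finset.range M, x n * ∑ k ∈ Finset.Icc 1 (n-1), cc k (n-k) * (x k * x (n-k)) := by
      rw [hL, Finset.mul_sum, ← Finset.sum_neg_distrib, ← Finset.sum_add_distrib]
      apply Finset.sum_le_sum
      intro n _
      by_cases hn : 2 ≤ n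
      · have e := heq n hn t ht
        have e' : b' n t = ∑ k ∈ Finset.Icc 1 (n-1), cc k (n-k) * b k t * b (n-k) t - lam n * b n t := by linarith
        rw [e', hx2]
        have key : Real.exp (lam n * t) * (b n t * ∑ k ∈ Finset.Icc 1 (n-1), cc k (n-k) * b k t * b (n-k) t) ≤ x n * ∑ k ∈ Finset.Icc 1 (n-1), cc k (n-k) * (x k * x (n-k)) := by
          rw [Finset.mul_sum, Finset.mul_sum, Finset.mul_sum]
          apply Finset.sum_le_sum
          intro k hk
          rw [Finset.mem_Icc] at hk
          by_cases h1 : k = 1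
          · subst h1; simp [hb1, hx1]
          by_cases h2 : n - k = 1
          · rw [h2]; simp [hb1, hx1]
          have hs := hsub k (n-k) (by omega) (by omega)
          rw [show k + (n-k) = n by omega] at hs
          have hc := hcc0 k (n-k) (by omega) (by omega)
          have hex : Real.exp (lam n * t) ≤ Real.exp (lam n * t / 2) * (Real.exp (lam k * t / 2) * Real.exp (lam (n-k) * t / 2)) := by
            rw [← Real.exp_add, ← Real.exp_add]
            apply Real.exp_le_exp.2
            nlinarith
          calc _ ≤ Real.exp (lam n * t) * (|b n t| * (cc k (n-k) * |b k t| * |b (n-k) t|)) := by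
                refine mul_le_mul_of_nonneg_left ?_ (Real.exp_pos _).le
                refine (le_abs_self _).trans (le_of_eq ?_)
                rw [abs_mul, abs_mul, abs_mul, abs_of_nonneg hc]
            _ ≤ (Real.exp (lam n * t / 2) * (Real.exp (lam k * t / 2) * Real.exp (lam (n-k) * t / 2))) * (|b n t| * (cc k (n-k) * |b k t| * |b (n-k) t|)) := by gcongr
            _ = _ := by simp only [hx]; ring
        linarith
      · have h1 : x n = 0 := by interval_cases n <;> assumption
        have h2 : b n t = 0 := by
          interval_cases n
          · exact hb0 t
          · exact hb1 t
        simp [h1, h2]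
    have hsq : √(F t) ≤ δ/16 := by
      rw [Real.sqrt_le_left (by positivity)]; exact hFt
    have hL0 : 0 ≤ L := le_trans (mul_nonneg hpos.le (hFnn t)) hLF
    have := mul_le_mul_of_nonneg_right hsq hL0
    nlinarith
  have hcont : ContinuousOn F (Set.Icc 0 T) := fun t ht =>
    ((hFd t ht.1).continuousWithinAt).mono Set.Icc_subset_Ici_self
  have hFr : ∀ t ∈ Set.Ico 0 T, HasDerivWithinAt F (F' t) (Set.Ici t) t := fun t ht =>
    (hFd t ht.1).mono (Set.Ici_subset_Ici.2 ht.1)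
  have boot : ∀ ⦃t⦄, t ∈ Set.Icc 0 T → F t ≤ (δ/16)^2 := by
    refine image_le_of_deriv_right_lt_deriv_boundary hcont hFr (B := fun _ => (δ/16)^2) (B' := fun _ => 0) (by simpa only [hF0] using hM) (fun x => hasDerivAt_const _ _) ?_
    intro t ht hteq
    have := main t ht.1 hteq.le
    have h2 : 0 < (1-δ) * lam 2 * F t := by
      rw [hteq]
      have : 0 < 1 - δ := by linarith
      positivity
    linarith
  have fin : ∀ ⦃t⦄, t ∈ Set.Icc 0 T → Real.exp (lam 2 * (1-δ) * t) * F t ≤ F 0 := by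
    have e1 : ∀ t, HasDerivAt (fun t => Real.exp (lam 2 * (1-δ) * t)) (Real.exp (lam 2 * (1-δ) * t) * (lam 2 * (1-δ))) t := by
      intro t
      have := ((hasDerivAt_id t).const_mul (lam 2 * (1-δ))).exp
      simpa using this
    refine image_le_of_deriv_right_le_deriv_boundary (f' := fun t => Real.exp (lam 2 * (1-δ) * t) * (lam 2 * (1-δ)) * F t + Real.exp (lam 2 * (1-δ) * t) * F' t) (B := fun _ => F 0) (B' := fun _ => 0) ?_ ?_ (by simp) continuousOn_const (fun x _ => hasDerivWithinAt_const _ _ _) ?_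
    · exact (Continuous.continuousOn (by fun_prop)).mul hcont
    · intro t ht
      exact (e1 t).hasDerivWithinAt.mul (hFr t ht)
    · intro t ht
      have := main t ht.1 (boot ⟨ht.1, ht.2.le⟩)
      have h2 := Real.exp_pos (lam 2 * (1-δ) * t)
      nlinarith
  have := fin (Set.right_mem_Icc.2 hT)
  rw [← hF0]
  calc F T = Real.exp (-(lam 2) * (1-δ) * T) * (Real.exp (lam 2 * (1-δ) * T) * F T) := by
        rw [← mul_assoc, ← Real.exp_add]
        rw [show -(lam 2) * (1-δ) * T + lam 2 * (1-δ) * T = 0 by ring]; simp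
    _ ≤ _ := by gcongr

theorem exponential_return_to_equilibrium
    (s : ℝ) (hs0 : 0 < s) (hs1 : s < 1) (β : ℝ → ℝ) (hβmeas : Measurable β)
    (c : ℝ) (hc : 0 < c)
    (hβbound : ∀ θ ∈ Set.Icc (-(π/4)) (π/4), θ ≠ 0 →
      c * |θ| ^ (-(1:ℝ) - 2*s) ≤ β θ ∧ β θ ≤ c⁻¹ * |θ| ^ (-(1:ℝ) - 2*s))
    (lam : ℕ → ℝ)
    (hlam : ∀ n : ℕ, 1 ≤ n →
      lam n = ∫ θ in (-(π/4))..(π/4),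
        β θ * (1 - Real.cos θ ^ (2*n) - Real.sin θ ^ (2*n)))
    (cc : ℕ → ℕ → ℝ)
    (hcc : ∀ k l : ℕ, 1 ≤ k → 1 ≤ l →
      cc k l = Real.sqrt ((2*(k:ℝ) + 2*(l:ℝ) + 1) / ((2*(k:ℝ) + 1) * (2*(l:ℝ) + 1))) *
        Real.sqrt (((2*k + 2*l).choose (2*k) : ℝ)) *
        ∫ θ in (-(π/4))..(π/4), β θ * Real.sin θ ^ (2*k) * Real.cos θ ^ (2*l)) :
    ∀ δ : ℝ, 0 < δ → δ < 1 → ∃ ε : ℝ, 0 < ε ∧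
      ∀ b b' : ℕ → ℝ → ℝ,
        (∀ n : ℕ, ∀ t : ℝ, 0 ≤ t → HasDerivWithinAt (b n) (b' n t) (Set.Ici 0) t) →
        (∀ t : ℝ, b 0 t = 0) → (∀ t : ℝ, b 1 t = 0) →
        (∀ n : ℕ, 2 ≤ n → ∀ t : ℝ, 0 ≤ t →
          b' n t + lam n * b n t =
            ∑ k ∈ Finset.Icc 1 (n-1), cc k (n-k) * b k t * b (n-k) t) →
        Summable (fun n : ℕ => b (n+2) 0 ^ 2) →
        (∑' n : ℕ, b (n+2) 0 ^ 2) ≤ ε^2 →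
        ∀ t : ℝ, 0 ≤ t →
          ∑' (n : ℕ), ENNReal.ofReal (Real.exp (lam (n+2) * t) * b (n+2) t ^ 2) ≤
            ENNReal.ofReal (Real.exp (-(lam 2) * (1-δ) * t) * ∑' (n : ℕ), b (n+2) 0 ^ 2) := by
  have hpi := Real.pi_pos
  have hle : -(π/4) ≤ π/4 := by linarith
  have hβ : ∀ θ ∈ Set.Icc (-(π/4)) (π/4), θ ≠ 0 → 0 < β θ := by
    intro θ hθ h0
    have : 0 < |θ| := abs_pos.2 h0
    exact lt_of_lt_of_le (by positivity) (hβbound θ hθ h0).1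
  have hint := aux_int s hs1 β hβmeas c hc hβbound
  obtain ⟨hcc0, hcoef⟩ := aux_coef β hβ hint aux_bin2 cc hcc
  have hmon : ∀ f g : ℝ → ℝ, IntervalIntegrable (fun θ => β θ * f θ) volume (-(π/4)) (π/4) →
      IntervalIntegrable (fun θ => β θ * g θ) volume (-(π/4)) (π/4) → f 0 = 0 → g 0 = 0 →
      (∀ θ ∈ Set.Icc (-(π/4)) (π/4), f θ ≤ g θ) →
      (∫ θ in (-(π/4))..(π/4), β θ * f θ) ≤ ∫ θ in (-(π/4))..(π/4), β θ * g θ := by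
    intro f g hf hg f0 g0 hfg
    apply intervalIntegral.integral_mono_on hle hf hg
    intro θ hθ
    by_cases h0 : θ = 0
    · subst h0; simp [f0, g0]
    · exact mul_le_mul_of_nonneg_left (hfg θ hθ) (hβ θ hθ h0).le
  set W : ℕ → ℝ → ℝ := fun n θ => min 1 (n * sin θ ^ 2) with hW
  set V : ℕ → ℝ → ℝ := fun n θ => 1 - (1 - sin θ ^ 2) ^ n - (sin θ ^ 2) ^ n with hV
  have hW0 : ∀ n, W n 0 = 0 := by intro n; simp [hW]
  have hV0 : ∀ n, 1 ≤ n → V n 0 = 0 := by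
    intro n hn; simp only [hV, sin_zero]; rw [zero_pow two_ne_zero, zero_pow (by omega)]; simp
  have hWi : ∀ n, IntervalIntegrable (fun θ => β θ * W n θ) volume (-(π/4)) (π/4) := by
    intro n
    refine hint _ (by simp only [hW]; fun_prop) n ?_
    intro θ
    simp only [hW]
    rw [abs_of_nonneg (by positivity)]
    exact min_le_right _ _
  have hVi : ∀ n, 1 ≤ n → IntervalIntegrable (fun θ => β θ * V n θ) volume (-(π/4)) (π/4) := by
    intro n hn
    refine hint _ (by simp only [hV]; fun_prop) (n+1) ?_
    intro θ
    simp only [hV]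
    have h0 := sq_nonneg (sin θ)
    have h1 := sin_sq_le_one θ
    set S := sin θ ^ 2
    have a1 := pow_le_of_le_one h0 h1 (n := n) (by omega)
    have a2 := pow_le_of_le_one (by linarith : 0 ≤ 1 - S) (by linarith) (n := n) (by omega)
    have a3 := one_add_mul_le_pow (by linarith : -2 ≤ -S) n
    have a4 : 0 ≤ S^n := by positivity
    rw [← sub_eq_add_neg] at a3
    rw [abs_of_nonneg (by linarith)]
    nlinarith
  have hlamV : ∀ n, 1 ≤ n → lam n = ∫ θ in (-(π/4))..(π/4), β θ * V n θ := by
    intro n hn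
    rw [hlam n hn]
    congr 1; ext θ
    simp only [hV]
    rw [← cos_sq', ← pow_mul, ← pow_mul]
  set mu : ℕ → ℝ := fun n => ∫ θ in (-(π/4))..(π/4), β θ * W n θ with hmu
  have hmu0 : ∀ n, 0 ≤ mu n := by
    intro n
    have := hmon (fun _ => 0) (W n) (by simp) (hWi n) rfl (hW0 n) (by intro θ _; simp only [hW]; positivity)
    simpa using this
  have hmusub : ∀ k l, mu (k+l) ≤ mu k + mu l := by
    intro k l
    simp only [hmu]
    rw [← intervalIntegral.integral_add (hWi k) (hWi l)]
    have e : ∀ θ, β θ * W k θ + β θ * W l θ = β θ * (W k θ + W l θ) := fun θ => by ring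
    simp only [e]
    refine hmon (W (k+l)) (fun θ => W k θ + W l θ) (hWi _) ?_ (hW0 _) (by simp [hW0]) ?_
    · simp only [← e]; exact (hWi k).add (hWi l)
    · intro θ _
      simp only [hW]
      push_cast
      have h1 : 0 ≤ (k:ℝ) * sin θ ^ 2 := by positivity
      have h2 : 0 ≤ (l:ℝ) * sin θ ^ 2 := by positivity
      rw [add_mul]
      generalize (k:ℝ) * sin θ ^ 2 = p at *
      generalize (l:ℝ) * sin θ ^ 2 = q at *
      rcases min_choice 1 p with hp | hp <;> rcases min_choice 1 q with hq | hq <;> rw [hp, hq]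
      · exact (min_le_left _ _).trans (by norm_num)
      · exact (min_le_left _ _).trans (by linarith)
      · exact (min_le_left _ _).trans (by linarith)
      · exact min_le_right _ _
  have hlm : ∀ n, 2 ≤ n → mu n ≤ 4 * lam n := by
    intro n hn
    rw [hlamV n (by omega), ← intervalIntegral.integral_const_mul]
    have e : ∀ θ, 4 * (β θ * V n θ) = β θ * (4 * V n θ) := fun θ => by ring
    simp only [e]
    refine hmon (W n) (fun θ => 4 * V n θ) (hWi _) ?_ (hW0 _) (by simp [hV0 n (by omega)]) ?_
    · simp only [← e]; exact (hVi n (by omega)).const_mul 4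
    · intro θ hθ
      exact aux_low n hn _ (sq_nonneg _) (aux_sin θ hθ)
  have hlsub : ∀ k l, 2 ≤ k → 2 ≤ l → lam (k+l) ≤ lam k + lam l := by
    intro k l hk hl
    rw [hlamV k (by omega), hlamV l (by omega), hlamV (k+l) (by omega)]
    rw [← intervalIntegral.integral_add (hVi k (by omega)) (hVi l (by omega))]
    have e : ∀ θ, β θ * V k θ + β θ * V l θ = β θ * (V k θ + V l θ) := fun θ => by ring
    simp only [e]
    refine hmon (V (k+l)) (fun θ => V k θ + V l θ) (hVi _ (by omega)) ?_ (hV0 _ (by omega)) (by simp [hV0 k (by omega), hV0 l (by omega)]) ?_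
    · simp only [← e]; exact (hVi k (by omega)).add (hVi l (by omega))
    · intro θ _
      exact aux_sub k l hk hl _ (sq_nonneg _) (sin_sq_le_one θ)
  have hlmono : ∀ n, 2 ≤ n → lam 2 ≤ lam n := by
    intro n hn
    rw [hlamV n (by omega), hlamV 2 (by omega)]
    refine hmon (V 2) (V n) (hVi _ (by omega)) (hVi _ (by omega)) (hV0 _ (by omega)) (hV0 _ (by omega)) ?_
    intro θ _
    have h0 := sq_nonneg (sin θ)
    have h1 := sin_sq_le_one θ
    simp only [hV]
    have a1 := pow_le_pow_of_le_one h0 h1 hn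
    have a2 := pow_le_pow_of_le_one (by linarith : 0 ≤ 1 - sin θ ^ 2) (by linarith) hn
    linarith
  have hVpos : ∀ θ ∈ Set.Icc (-(π/4)) (π/4), θ ≠ 0 → 0 < V 2 θ := by
    intro θ hθ h0
    have h1 := aux_sin θ hθ
    have h2 : sin θ ≠ 0 := by
      intro h
      rw [sin_eq_zero_iff_of_lt_of_lt (by linarith [hθ.1]) (by linarith [hθ.2])] at h
      exact h0 h
    have h3 : 0 < sin θ ^ 2 := by positivity
    simp only [hV]
    nlinarith
  have hpos : 0 < lam 2 := by
    rw [hlamV 2 (by omega)]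
    have hi := hVi 2 (by omega)
    have hi1 : IntervalIntegrable (fun θ => β θ * V 2 θ) volume (-(π/4)) 0 := by
      refine hi.mono_set ?_
      rw [Set.uIcc_of_le (by linarith), Set.uIcc_of_le (by linarith)]
      exact Set.Icc_subset_Icc le_rfl (by linarith)
    have hi2 : IntervalIntegrable (fun θ => β θ * V 2 θ) volume 0 (π/4) := by
      refine hi.mono_set ?_
      rw [Set.uIcc_of_le (by linarith), Set.uIcc_of_le (by linarith)]
      exact Set.Icc_subset_Icc (by linarith) le_rfl
    rw [← intervalIntegral.integral_add_adjacent_intervals hi1 hi2]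
    apply add_pos
    · apply intervalIntegral.intervalIntegral_pos_of_pos_on hi1 _ (by linarith)
      intro θ hθ
      have hm : θ ∈ Set.Icc (-(π/4)) (π/4) := ⟨hθ.1.le, by linarith [hθ.2]⟩
      exact mul_pos (hβ θ hm hθ.2.ne) (hVpos θ hm hθ.2.ne)
    · apply intervalIntegral.intervalIntegral_pos_of_pos_on hi2 _ (by linarith)
      intro θ hθ
      have hm : θ ∈ Set.Icc (-(π/4)) (π/4) := ⟨by linarith [hθ.1], hθ.2.le⟩
      exact mul_pos (hβ θ hm hθ.1.ne') (hVpos θ hm hθ.1.ne')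
  have htri := aux_tri_s16 lam mu cc hmu0 hmusub hlm hcoef
  intro δ hδ0 hδ1
  refine ⟨δ/16, by positivity, ?_⟩
  intro b b' hd hb0 hb1 heq hsum hsm t ht
  apply ENNReal.tsum_le_of_sum_range_le
  intro N
  rw [← ENNReal.ofReal_sum_of_nonneg (fun n _ => by positivity)]
  apply ENNReal.ofReal_le_ofReal
  have hpart : ∑ n ∈ Finset.range (N+2), b n 0 ^ 2 ≤ ∑' n : ℕ, b (n+2) 0 ^ 2 := by
    rw [Finset.sum_range_succ', Finset.sum_range_succ']
    simp only [zero_add, hb0, hb1, add_assoc]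
    simpa using hsum.sum_le_tsum (Finset.range N) (fun n _ => sq_nonneg _)
  have := aux_ode lam cc hpos hlmono hlsub hcc0 htri δ hδ0 hδ1 b b' hd hb0 hb1 heq (N+2) (hpart.trans hsm) t ht
  rw [Finset.sum_range_succ', Finset.sum_range_succ'] at this
  simp only [zero_add, hb0, hb1] at this
  calc _ ≤ _ := by simpa [add_assoc] using this
    _ ≤ _ := mul_le_mul_of_nonneg_left hpart (Real.exp_pos _).le
end
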